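/- For the minimax control model: (i) the sets S_M and tilde-S_M are analytic; they are Borel if Γ_1 and Γ_2 are Borel; (ii) if ζ : 𝕏 → P(Ω) is a universally measurable map with ζ(x) ∈ tilde-S_M(x) for all x ∈ 𝕏, then there exist universally measurable policies π_1 ∈ Π_1 and π_2 ∈ Π_2 such that ρ_x[π_1, π_2] = ζ(x) for all x ∈ 𝕏. -/

import Mathlib

open MeasureTheory ProbabilityTheory Filter
open scoped ENNReal NNReal Topology

noncomputable section

namespace PaperStmt

/-- The Borel σ-algebra of the topology of weak convergence on the space of Borel
probability measures. -/
instance instMeasProb {Ω : Type*} [MeasurableSpace Ω] [TopologicalSpace Ω]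
    [OpensMeasurableSpace Ω] : MeasurableSpace (ProbabilityMeasure Ω) := borel _


/-- Helper instance: the product topology on `P(Ω) × P(Ω)`. -/
instance instTopPMProd {α : Type*} [MeasurableSpace α] [TopologicalSpace α]
    [OpensMeasurableSpace α] :
    TopologicalSpace (ProbabilityMeasure α × ProbabilityMeasure α) :=
  @instTopologicalSpaceProd _ _ inferInstance inferInstance

/-- Helper instance: the product σ-algebra on `P(Ω) × P(Ω)`. -/
instance instMeasPMProd {α : Type*} [MeasurableSpace α] [TopologicalSpace α]
    [OpensMeasurableSpace α] :
    MeasurableSpace (ProbabilityMeasure α × ProbabilityMeasure α) :=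
  @Prod.instMeasurableSpace _ _ inferInstance inferInstance

/-- A set is universally measurable if it is measurable with respect to the completion of
every Borel probability measure. -/
def UniversallyMeasurableSet {α : Type*} [MeasurableSpace α] (s : Set α) : Prop :=
  ∀ μ : Measure α, IsProbabilityMeasure μ → NullMeasurableSet s μ

/-- A map between measurable spaces is universally measurable if preimages of measurable
sets are universally measurable. -/
def UniversallyMeasurable {α β : Type*} [MeasurableSpace α] [MeasurableSpace β]
    (f : α → β) : Prop :=
  ∀ s : Set β, MeasurableSet s → UniversallyMeasurableSet (f ⁻¹' s)

/-- Upper semianalytic functions on a topological (Borel) space. -/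
def UpperSemianalytic {γ : Type*} [TopologicalSpace γ] (f : γ → EReal) : Prop :=
  ∀ r : ℝ, MeasureTheory.AnalyticSet {x | (r : EReal) ≤ f x}

/-- The sample space `Ω = (𝕏 × 𝔸₁ × 𝔸₂)^∞` of the minimax control model. -/
abbrev TrajM (X A1 A2 : Type*) := ℕ → X × A1 × A2

/-- Histories `h_n = (x_0, a_0, …, x_n)` of the minimax model. -/
abbrev HistM (X A1 A2 : Type*) (n : ℕ) := (Fin n → X × A1 × A2) × X

/-- Controller information vectors `i_n = (x_0, a¹_0, x_1, …, x_n)`. -/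
abbrev InfoM (X A1 : Type*) (n : ℕ) := (Fin n → X × A1) × X

/-- The controller information vector determined by a history. -/
def infoM {X A1 A2 : Type*} : ∀ {n : ℕ}, HistM X A1 A2 n → InfoM X A1 n :=
  fun {_} h => (fun k => ((h.1 k).1, (h.1 k).2.1), h.2)

/-- The controller information vector determined by a trajectory, up to time `n`. -/
def iProjM {X A1 A2 : Type*} (n : ℕ) (ω : TrajM X A1 A2) : InfoM X A1 n :=
  (fun k : Fin n => ((ω k.val).1, (ω k.val).2.1), (ω n).1)

/-- A universally measurable policy for player 1 (the controller), who observes only the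
information vectors `i_n`. -/
structure Policy1 {X A1 : Type*} [MeasurableSpace X] [MeasurableSpace A1]
    (Acts1 : X → Set A1) where
  μ : ∀ n : ℕ, InfoM X A1 n → Measure A1
  isProb : ∀ n i, IsProbabilityMeasure (μ n i)
  umeas : ∀ (n : ℕ) (B : Set A1), MeasurableSet B →
    UniversallyMeasurable fun i : InfoM X A1 n => μ n i B
  feasible : ∀ n i, μ n i (Acts1 i.2) = 1

/-- A universally measurable policy for player 2 (the opponent), who observes the full
histories `h_n`. -/
structure Policy2 (A1 : Type*) {X A2 : Type*} [MeasurableSpace X] [MeasurableSpace A1]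
    [MeasurableSpace A2] (Acts2 : X → Set A2) where
  μ : ∀ n : ℕ, HistM X A1 A2 n → Measure A2
  isProb : ∀ n h, IsProbabilityMeasure (μ n h)
  umeas : ∀ (n : ℕ) (B : Set A2), MeasurableSet B →
    UniversallyMeasurable fun h : HistM X A1 A2 n => μ n h B
  feasible : ∀ n h, μ n h (Acts2 h.2) = 1

variable {X A1 A2 : Type*} [MeasurableSpace X] [MeasurableSpace A1] [MeasurableSpace A2]

/-- The iterated integral giving the finite-dimensional distributions of the minimax
control model: the two players act simultaneously and independently. -/
def histIntM (p0 : Measure X) (q : Kernel (X × A1 × A2) X)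
    (ν1 : ∀ n : ℕ, InfoM X A1 n → Measure A1)
    (ν2 : ∀ n : ℕ, HistM X A1 A2 n → Measure A2) :
    ∀ n : ℕ, (HistM X A1 A2 n → ℝ≥0∞) → ℝ≥0∞
  | 0, g => ∫⁻ x, g (Fin.elim0, x) ∂p0
  | n + 1, g => histIntM p0 q ν1 ν2 n fun h =>
      ∫⁻ a1, ∫⁻ a2, ∫⁻ y, g (Fin.snoc h.1 (h.2, a1, a2), y)
        ∂(q (h.2, a1, a2)) ∂(ν2 n h) ∂(ν1 n (infoM h))

/-- `InducesM q π1 π2 p0 p` says that `p` is the strategic measure `ρ_{p0}[π₁, π₂]`. -/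
def InducesM (q : Kernel (X × A1 × A2) X) {Acts1 : X → Set A1} {Acts2 : X → Set A2}
    (π1 : Policy1 Acts1) (π2 : Policy2 A1 Acts2)
    (p0 : Measure X) (p : Measure (TrajM X A1 A2)) : Prop :=
  ∀ (n : ℕ) (B : Set (HistM X A1 A2 n)), MeasurableSet B →
    p {ω : TrajM X A1 A2 | ((fun i : Fin n => ω i.val), (ω n).1) ∈ B}
      = histIntM p0 q π1.μ π2.μ n (B.indicator fun _ => 1)

/-- The set `S_M` of all strategic measures of the minimax control model. -/
def SM (q : Kernel (X × A1 × A2) X) (Acts1 : X → Set A1) (Acts2 : X → Set A2) :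
    Set (ProbabilityMeasure (TrajM X A1 A2)) :=
  {p | ∃ (π1 : Policy1 Acts1) (π2 : Policy2 A1 Acts2) (p0 : ProbabilityMeasure X),
    InducesM q π1 π2 p0.toMeasure p.toMeasure}

/-- The section `tilde-S_M(x)`. -/
def tsecM (q : Kernel (X × A1 × A2) X) (Acts1 : X → Set A1) (Acts2 : X → Set A2) (x : X) :
    Set (ProbabilityMeasure (TrajM X A1 A2)) :=
  {p | p ∈ SM q Acts1 Acts2 ∧ p.toMeasure.map (fun ω => (ω 0).1) = Measure.dirac x}

/-- The set `tilde-S_M ⊂ 𝕏 × P(Ω)`. -/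
def tsetM (q : Kernel (X × A1 × A2) X) (Acts1 : X → Set A1) (Acts2 : X → Set A2) :
    Set (X × ProbabilityMeasure (TrajM X A1 A2)) :=
  {xp | xp.2 ∈ tsecM q Acts1 Acts2 xp.1}

/-- Assumption `AC` (Assumption 4.1 / `cond-minimax-abscont`): while player 1 uses the same
policy, the marginal distributions of the induced processes on the controller information
spaces `I_n` are mutually absolutely continuous. -/
def AssumpAC (q : Kernel (X × A1 × A2) X) (Acts1 : X → Set A1) (Acts2 : X → Set A2) : Prop :=
  ∀ (π1 : Policy1 Acts1) (π2 π2' : Policy2 A1 Acts2) (x : X)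
    (p p' : ProbabilityMeasure (TrajM X A1 A2)),
    InducesM q π1 π2 (Measure.dirac x) p.toMeasure →
    InducesM q π1 π2' (Measure.dirac x) p'.toMeasure →
    ∀ n : ℕ, p.toMeasure.map (iProjM n) ≪ p'.toMeasure.map (iProjM n)

end PaperStmt

namespace PaperStmt

section Branches

/-- The set of sequences of naturals extending the finite list `s`. -/
def cyl (s : List ℕ) : Set (ℕ → ℕ) := {u | ∀ i (h : i < s.length), u i = s[i]}

/-- The finite branches obtained by iterating a choice of successor. -/
def branch (c : List ℕ → ℕ) : ℕ → List ℕ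
  | 0 => []
  | n + 1 => branch c n ++ [c (branch c n)]

/-- The infinite branch obtained by iterating a choice of successor. -/
def branchLim (c : List ℕ → ℕ) (n : ℕ) : ℕ := c (branch c n)

lemma cyl_nil : cyl [] = Set.univ := by simp [cyl]

lemma cyl_append (s : List ℕ) (k : ℕ) : cyl (s ++ [k]) = {u ∈ cyl s | u s.length = k} := by
  ext u
  simp only [cyl, List.length_append, List.length_singleton, Set.mem_ofPred_eq]
  constructor
  · intro h
    refine ⟨fun i hi => ?_, ?_⟩
    · rw [h i (by omega), List.getElem_append_left hi]
    · rw [h s.length (by omega)]; simp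
  · rintro ⟨h, hk⟩ i hi
    rcases Nat.lt_succ_iff_lt_or_eq.1 hi with hi' | rfl
    · rw [List.getElem_append_left hi', h i hi']
    · simp [hk]

lemma cyl_eq_iUnion (s : List ℕ) : cyl s = ⋃ k, cyl (s ++ [k]) := by
  ext u; simp [cyl_append]

lemma isClosed_cyl (s : List ℕ) : IsClosed (cyl s) := by
  simp only [cyl, Set.ofPred_forall]
  exact isClosed_iInter fun i => isClosed_iInter fun h =>
    isClosed_eq (continuous_apply i) continuous_const

lemma branch_eq_map (c : List ℕ → ℕ) (n : ℕ) :
    branch c n = (List.range n).map (branchLim c) := by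
  induction n with
  | zero => rfl
  | succ n ih => rw [List.range_succ, List.map_append, ← ih]; rfl

lemma mem_cyl_branch {c : List ℕ → ℕ} {n : ℕ} {u : ℕ → ℕ} :
    u ∈ cyl (branch c n) ↔ ∀ i < n, u i = branchLim c i := by
  rw [branch_eq_map]
  simp [cyl]

variable {Y : Type*} [TopologicalSpace Y] [T2Space Y]

/-- A point adherent to the images of all the cylinders along a branch is the image of the
branch. -/
lemma eq_of_forall_mem_closure {f : (ℕ → ℕ) → Y} (hf : Continuous f) (c : List ℕ → ℕ) {y : Y}
    (hy : ∀ n, y ∈ closure (f '' cyl (branch c n))) : f (branchLim c) = y := by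
  by_contra hne
  obtain ⟨V, U, hV, hU, hσV, hyU, hd⟩ := t2_separation hne
  obtain ⟨_, ⟨x, n, rfl⟩, hx, hsub⟩ :=
    (PiNat.isTopologicalBasis_cylinders (fun _ : ℕ => ℕ)).mem_nhds_iff.1
      ((hV.preimage hf).mem_nhds hσV)
  obtain ⟨z, hzU, u, hu, rfl⟩ := mem_closure_iff.1 (hy n) U hU hyU
  refine Set.disjoint_left.1 hd (hsub ?_) hzU
  rw [mem_cyl_branch] at hu
  intro i hi
  rw [hu i hi]; exact hx i hi

lemma nullMeasurableSet_range [MeasurableSpace Y] [OpensMeasurableSpace Y]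
    {f : (ℕ → ℕ) → Y} (hf : Continuous f) (μ : Measure Y) [IsFiniteMeasure μ] :
    NullMeasurableSet (Set.range f) μ := by
  classical
  set H : List ℕ → Set Y := fun s => toMeasurable μ (f '' cyl s) ∩ closure (f '' cyl s) with hH
  have hHm : ∀ s, MeasurableSet (H s) := fun s =>
    (measurableSet_toMeasurable _ _).inter isClosed_closure.measurableSet
  have hsub : ∀ s, f '' cyl s ⊆ H s := fun s =>
    Set.subset_inter (subset_toMeasurable _ _) subset_closure
  set N : List ℕ → Set Y := fun s => H s \ ⋃ k, H (s ++ [k]) with hN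
  have hN0 : ∀ s, μ (N s) = 0 := by
    intro s
    have hW : MeasurableSet (⋃ k, H (s ++ [k]))ᶜ := (MeasurableSet.iUnion fun k => hHm _).compl
    have h1 : f '' cyl s ∩ (⋃ k, H (s ++ [k]))ᶜ = ∅ := by
      rw [← Set.sdiff_eq, Set.sdiff_eq_empty, cyl_eq_iUnion, Set.image_iUnion]
      exact Set.iUnion_mono fun k => hsub _
    refine measure_mono_null (t := toMeasurable μ (f '' cyl s) ∩ (⋃ k, H (s ++ [k]))ᶜ)
      (fun y hy => ⟨hy.1.1, hy.2⟩) ?_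
    rw [Measure.measure_toMeasurable_inter hW (measure_ne_top _ _), h1, measure_empty]
  have hlow : H [] \ ⋃ s, N s ⊆ Set.range f := by
    rintro y ⟨hy, hyN⟩
    have hstep : ∀ s, ∃ k, y ∈ H s → y ∈ H (s ++ [k]) := by
      intro s
      by_cases h : y ∈ H s
      · by_contra! hcon
        exact hyN (Set.mem_iUnion.2 ⟨s, h, by simpa using fun k => (hcon k).2⟩)
      · exact ⟨0, fun h' => absurd h' h⟩
    choose c hc using hstep
    have hb : ∀ n, y ∈ H (branch c n) := by
      intro n
      induction n with
      | zero => exact hy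
      | succ n ih => exact hc _ ih
    exact ⟨_, eq_of_forall_mem_closure hf c fun n => (hb n).2⟩
  have hup : Set.range f ⊆ H [] := by
    have := hsub []
    rwa [cyl_nil, Set.image_univ] at this
  have hN' : μ (⋃ s, N s) = 0 := measure_iUnion_null hN0
  refine ((hHm []).nullMeasurableSet).congr ?_
  refine (LE.le.eventuallyLE hup).antisymm ?_ |>.symm
  rw [ae_le_set]
  refine measure_mono_null ?_ hN'
  intro y hy
  by_contra h
  exact hy.2 (hlow ⟨hy.1, h⟩)

end Branches

section UniversalMeasurability

/-- Analytic sets are universally measurable. -/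
lemma universallyMeasurableSet_of_analyticSet {Y : Type*} [TopologicalSpace Y] [T2Space Y]
    [MeasurableSpace Y] [OpensMeasurableSpace Y] {s : Set Y} (hs : AnalyticSet s) :
    UniversallyMeasurableSet s := by
  intro μ _
  rw [AnalyticSet] at hs
  rcases hs with rfl | ⟨f, hf, rfl⟩
  · exact MeasurableSet.empty.nullMeasurableSet
  · exact nullMeasurableSet_range hf μ

/-- The σ-algebra of universally measurable sets. -/
abbrev univSigma (Y : Type*) [MeasurableSpace Y] : MeasurableSpace Y where
  MeasurableSet' := UniversallyMeasurableSet
  measurableSet_empty := fun _ _ => MeasurableSet.empty.nullMeasurableSet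
  measurableSet_compl := fun _ h μ hμ => (h μ hμ).compl
  measurableSet_iUnion := fun _ h μ hμ => NullMeasurableSet.iUnion fun i => h i μ hμ

variable {Y Z : Type*} [MeasurableSpace Y] [MeasurableSpace Z]

lemma aemeasurable_of_univSigma [MeasurableSpace.CountablyGenerated Z] {f : Y → Z}
    (hf : Measurable[univSigma Y] f) (μ : Measure Y) [IsProbabilityMeasure μ] :
    AEMeasurable f μ :=
  NullMeasurable.aemeasurable fun _ hs => hf hs μ inferInstance

/-- Preimages of universally measurable sets under measurable maps. -/
lemma measurable_univSigma_univSigma {f : Y → Z} (hf : Measurable f) :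
    Measurable[univSigma Y, univSigma Z] f := by
  intro s hs μ _
  have := Measure.isProbabilityMeasure_map (μ := μ) hf.aemeasurable
  exact (hs (μ.map f) this).preimage (hf.quasiMeasurePreserving μ)

/-- **Jankov–von Neumann** measurable selection, for continuous maps on the Baire space. -/
lemma exists_section_of_continuous {Y : Type*} [TopologicalSpace Y] [T2Space Y]
    [MeasurableSpace Y] [OpensMeasurableSpace Y] {f : (ℕ → ℕ) → Y} (hf : Continuous f) :
    ∃ σ : Y → ℕ → ℕ, Measurable[univSigma Y] σ ∧ ∀ y ∈ Set.range f, f (σ y) = y := by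
  classical
  have hA : ∀ s, MeasurableSet[univSigma Y] (f '' cyl s) := fun s =>
    universallyMeasurableSet_of_analyticSet ((isClosed_cyl s).analyticSet.image_of_continuous hf)
  let c : Y → List ℕ → ℕ := fun y s =>
    if h : ∃ k, y ∈ f '' cyl (s ++ [k]) then Nat.find h else 0
  have hspec : ∀ y s, y ∈ f '' cyl s → y ∈ f '' cyl (s ++ [c y s]) := by
    intro y s hy
    rw [cyl_eq_iUnion, Set.image_iUnion, Set.mem_iUnion] at hy
    simp only [c, dif_pos hy]
    exact Nat.find_spec hy
  have hcm : ∀ s, Measurable[univSigma Y] fun y => c y s := by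
    intro s
    refine @measurable_to_countable' ℕ Y _ _ (univSigma Y) _ fun k => ?_
    have : (fun y => c y s) ⁻¹' {k} =
        ((f '' cyl (s ++ [k])) ∩ ⋂ j ∈ Finset.range k, (f '' cyl (s ++ [j]))ᶜ) ∪
          (if k = 0 then ⋂ j, (f '' cyl (s ++ [j]))ᶜ else ∅) := by
      ext y
      by_cases h : ∃ k, y ∈ f '' cyl (s ++ [k])
      · have h' : ¬ ∀ j, y ∉ f '' cyl (s ++ [j]) := by push Not; exact h
        have : (y ∈ if k = 0 then ⋂ j, (f '' cyl (s ++ [j]))ᶜ else ∅) ↔ False := by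
          split_ifs
          · simpa only [Set.mem_iInter, Set.mem_compl_iff, iff_false] using h'
          · simp
        rw [Set.mem_union, this, or_false]
        simp only [Set.mem_preimage, c, dif_pos h, Set.mem_singleton_iff, Nat.find_eq_iff,
          Set.mem_inter_iff, Set.mem_iInter, Set.mem_compl_iff, Finset.mem_range]
      · have h' : ∀ j, y ∉ f '' cyl (s ++ [j]) := by push Not at h; exact h
        simp only [Set.mem_preimage, c, dif_neg h, Set.mem_singleton_iff, Set.mem_union,
          Set.mem_inter_iff, h' k, false_and, false_or]
        split_ifs with hk
        · simp only [hk, true_iff, Set.mem_iInter, Set.mem_compl_iff]; exact h'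
        · simp [Ne.symm hk]
    rw [this]
    refine @MeasurableSet.union Y (univSigma Y) _ _ (@MeasurableSet.inter Y (univSigma Y) _ _
      (hA _) (@Finset.measurableSet_biInter _ _ (univSigma Y) _ _ fun j _ =>
        @MeasurableSet.compl Y _ (univSigma Y) (hA _))) ?_
    split_ifs
    · exact @MeasurableSet.iInter Y ℕ (univSigma Y) _ _ fun j =>
        @MeasurableSet.compl Y _ (univSigma Y) (hA _)
    · exact @MeasurableSet.empty Y (univSigma Y)
  have hbm : ∀ n t, MeasurableSet[univSigma Y] {y | branch (c y) n = t} := by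
    intro n
    induction n with
    | zero => exact fun t => @MeasurableSet.const Y (univSigma Y) ([] = t)
    | succ n ih =>
      intro t
      have : {y | branch (c y) (n + 1) = t} =
          ⋃ s, ({y | branch (c y) n = s} ∩ (fun y => c y s) ⁻¹' {k | s ++ [k] = t}) := by
        ext y
        simp [branch]
      rw [this]
      exact @MeasurableSet.iUnion _ _ (univSigma Y) _ _ fun s =>
        @MeasurableSet.inter _ (univSigma Y) _ _ (ih s) (hcm s trivial)
  refine ⟨fun y => branchLim (c y), ?_, ?_⟩
  · refine @measurable_pi_lambda _ _ _ (univSigma Y) _ _ fun n => ?_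
    refine @measurable_to_countable' ℕ Y _ _ (univSigma Y) _ fun k => ?_
    have : (fun y => branchLim (c y) n) ⁻¹' {k} =
        ⋃ s, ({y | branch (c y) n = s} ∩ (fun y => c y s) ⁻¹' {k}) := by
      ext y
      simp [branchLim]
    rw [this]
    exact @MeasurableSet.iUnion _ _ (univSigma Y) _ _ fun s =>
      @MeasurableSet.inter _ (univSigma Y) _ _ (hbm n s) (hcm s trivial)
  · intro y hy
    refine eq_of_forall_mem_closure hf _ fun n => subset_closure ?_
    induction n with
    | zero => simpa [branch, cyl_nil] using hy
    | succ n ih => exact hspec _ _ ih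

/-- **Jankov–von Neumann** selection of a set-valued map with analytic graph. -/
lemma exists_universally_measurable_selection {X A : Type*}
    [TopologicalSpace X] [T2Space X] [MeasurableSpace X] [OpensMeasurableSpace X]
    [TopologicalSpace A] [MeasurableSpace A] [BorelSpace A]
    {F : X → Set A} (hne : ∀ x, (F x).Nonempty)
    (hF : AnalyticSet {xa : X × A | xa.2 ∈ F xa.1}) :
    ∃ s : X → A, Measurable[univSigma X] s ∧ ∀ x, s x ∈ F x := by
  rcases isEmpty_or_nonempty X with hX | ⟨⟨x₀⟩⟩
  · exact ⟨hX.elim, fun t _ μ _ => by rw [Set.eq_empty_of_isEmpty (_ ⁻¹' t)]; simp,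
      fun x => hX.elim x⟩
  rw [AnalyticSet] at hF
  rcases hF with h | ⟨f, hf, hr⟩
  · obtain ⟨a, ha⟩ := hne x₀
    exact absurd (show (x₀, a) ∈ {xa : X × A | xa.2 ∈ F xa.1} from ha) (by simp [h])
  obtain ⟨σ, hσ, hσf⟩ := exists_section_of_continuous (continuous_fst.comp hf)
  refine ⟨fun x => (f (σ x)).2, ?_, fun x => ?_⟩
  · exact (continuous_snd.comp hf).measurable.comp hσ
  · obtain ⟨a, ha⟩ := hne x
    obtain ⟨u, hu⟩ : (x, a) ∈ Set.range f := by rw [hr]; exact ha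
    have h1 : (f (σ x)).1 = x := hσf x ⟨u, by simp [hu]⟩
    have h2 : f (σ x) ∈ {xa : X × A | xa.2 ∈ F xa.1} := hr ▸ ⟨_, rfl⟩
    simpa [h1] using h2

end UniversalMeasurability

section WeakTopology

variable {Ω : Type*} [TopologicalSpace Ω] [MeasurableSpace Ω]

lemma lowerSemicontinuous_apply [OpensMeasurableSpace Ω] [HasOuterApproxClosed Ω] {U : Set Ω}
    (hU : IsOpen U) :
    LowerSemicontinuous fun p : ProbabilityMeasure Ω => (p : Measure Ω) U := by
  intro p r hr
  exact eventually_lt_of_lt_liminf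
    (hr.trans_le (ProbabilityMeasure.le_liminf_measure_open_of_tendsto tendsto_id hU))

/-- The sets `{p | r < p V}`, for `V` a finite union of basic open sets and `r` rational. -/
def weakSubbasis (Ω : Type*) [TopologicalSpace Ω] [SecondCountableTopology Ω]
    [MeasurableSpace Ω] : Set (Set (ProbabilityMeasure Ω)) :=
  (fun Fr : Set (Set Ω) × ℚ => {p | ((Real.toNNReal Fr.2 : ℝ≥0) : ℝ≥0∞) < (p : Measure Ω) (⋃₀ Fr.1)}) ''
    ({F | F.Finite ∧ F ⊆ TopologicalSpace.countableBasis Ω} ×ˢ Set.univ)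

lemma weakTopology_eq_generateFrom [SecondCountableTopology Ω] [OpensMeasurableSpace Ω]
    [HasOuterApproxClosed Ω] :
    (inferInstance : TopologicalSpace (ProbabilityMeasure Ω)) =
      TopologicalSpace.generateFrom (weakSubbasis Ω) ∧ (weakSubbasis Ω).Countable := by
  have hB := TopologicalSpace.isBasis_countableBasis Ω
  have hBc := TopologicalSpace.countable_countableBasis Ω
  have hc : (weakSubbasis Ω).Countable :=
    ((Set.countable_ofPred_finite_subset hBc).prod Set.countable_univ).image _
  refine ⟨le_antisymm ?_ ?_, hc⟩
  · refine le_generateFrom ?_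
    rintro _ ⟨⟨F, r⟩, ⟨⟨-, hF⟩, -⟩, rfl⟩
    exact (lowerSemicontinuous_apply
      (isOpen_sUnion fun V hV => hB.isOpen (hF hV))).isOpen_preimage _
  · set t' := TopologicalSpace.generateFrom (weakSubbasis Ω) with ht'
    have hsc : @SecondCountableTopology _ t' := @SecondCountableTopology.mk _ t' ⟨_, hc, rfl⟩
    refine le_of_nhds_le_nhds fun p => ?_
    have hcg : (@nhds _ t' p).IsCountablyGenerated :=
      @FirstCountableTopology.nhds_generated_countable _ t'
        (by let _ := t'; infer_instance) p
    refine tendsto_id'.1 ?_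
    refine tendsto_of_forall_isOpen_le_liminf' (μs := id) fun G hG => ?_
    refine le_of_forall_lt fun s hs => ?_
    obtain ⟨r, hsr, hrG⟩ := ENNReal.lt_iff_exists_rat_btwn.1 hs |>.imp fun _ h => h.2
    obtain ⟨S, hSB, rfl⟩ := hB.open_eq_sUnion hG
    have hSc : S.Countable := hBc.mono hSB
    obtain ⟨F, hFS, hF, hrF⟩ : ∃ F ⊆ S, F.Finite ∧
        ((Real.toNNReal r : ℝ≥0) : ℝ≥0∞) < (p : Measure Ω) (⋃₀ F) := by
      rcases S.eq_empty_or_nonempty with rfl | hne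
      · simp at hrG
      obtain ⟨e, he⟩ := hSc.exists_eq_range hne
      have hmono : Monotone fun n => ⋃ i ∈ Finset.range n, e i := fun m n hmn =>
fun x hx => by
          simp only [Set.mem_iUnion, Finset.mem_range, exists_prop] at hx ⊢
          obtain ⟨i, hi, hx⟩ := hx
          exact ⟨i, by omega, hx⟩
      have hU : ⋃₀ S = ⋃ n, ⋃ i ∈ Finset.range n, e i := by
        ext x
        simp only [he, Set.mem_sUnion, Set.mem_range, exists_exists_eq_and, Set.mem_iUnion,
          Finset.mem_range, exists_prop]
        exact ⟨fun ⟨i, hi⟩ => ⟨i + 1, i, Nat.lt_succ_self i, hi⟩, fun ⟨_, i, _, hi⟩ => ⟨i, hi⟩⟩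
      rw [hU, hmono.measure_iUnion, lt_iSup_iff] at hrG
      obtain ⟨n, hn⟩ := hrG
      refine ⟨e '' (Finset.range n), ?_, (Finset.finite_toSet _).image _, ?_⟩
      · rw [he]; exact Set.image_subset_range _ _
      · rwa [Set.sUnion_image]
    have hmem : {q : ProbabilityMeasure Ω |
        ((Real.toNNReal r : ℝ≥0) : ℝ≥0∞) < (q : Measure Ω) (⋃₀ F)} ∈ @nhds _ t' p := by
      refine @IsOpen.mem_nhds _ t' _ _ ?_ hrF
      refine TopologicalSpace.isOpen_generateFrom_of_mem
        ⟨(F, r), ⟨⟨hF, hFS.trans hSB⟩, trivial⟩, rfl⟩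
    refine hsr.trans_le (le_liminf_of_le (by isBoundedDefault) ?_)
    filter_upwards [hmem] with q hq
    exact hq.le.trans (measure_mono (Set.sUnion_subset_sUnion hFS))

variable [SecondCountableTopology Ω] [HasOuterApproxClosed Ω]

instance instSecondCountableProb [OpensMeasurableSpace Ω] :
    SecondCountableTopology (ProbabilityMeasure Ω) :=
  ⟨_, weakTopology_eq_generateFrom.2, weakTopology_eq_generateFrom.1⟩

instance instBorelProb [OpensMeasurableSpace Ω] : BorelSpace (ProbabilityMeasure Ω) := ⟨rfl⟩

omit [SecondCountableTopology Ω] in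
lemma measurable_toMeasure [BorelSpace Ω] :
    Measurable fun p : ProbabilityMeasure Ω => (p : Measure Ω) :=
  Measurable.measure_of_isPiSystem_of_isProbabilityMeasure
    BorelSpace.measurable_eq isPiSystem_isOpen
    fun _ hU => (lowerSemicontinuous_apply hU).measurable

lemma measurable_of_measurable_toMeasure [OpensMeasurableSpace Ω] {Z : Type*} [MeasurableSpace Z]
    {g : Z → ProbabilityMeasure Ω} (hg : Measurable fun z => (g z : Measure Ω)) :
    Measurable g := by
  have h : (inferInstance : MeasurableSpace (ProbabilityMeasure Ω)) =
      MeasurableSpace.generateFrom (weakSubbasis Ω) :=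
    borel_eq_generateFrom_of_subbasis weakTopology_eq_generateFrom.1
  change Measurable[_, instMeasProb] g
  have h' : (instMeasProb : MeasurableSpace (ProbabilityMeasure Ω)) = _ := h
  rw [h']
  refine measurable_generateFrom ?_
  rintro _ ⟨⟨F, r⟩, ⟨⟨-, hF⟩, -⟩, rfl⟩
  have hV : IsOpen (⋃₀ F) := isOpen_sUnion fun V hV =>
    (TopologicalSpace.isBasis_countableBasis Ω).isOpen (hF hV)
  exact ((Measure.measurable_coe hV.measurableSet).comp hg) measurableSet_Ioi

end WeakTopology

section AnalyticProb

/-- A Borel parametrization of the probability measures on a standard Borel space. -/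
lemma exists_measurable_surjective_prob (Ω : Type*) [MeasurableSpace Ω] [StandardBorelSpace Ω]
    [Nonempty Ω] :
    ∃ T : (ℚ → ℝ) → Measure Ω, Measurable T ∧ (∀ a, IsProbabilityMeasure (T a)) ∧
      ∀ p : Measure Ω, IsProbabilityMeasure p → ∃ a, T a = p := by
  obtain ⟨e, he⟩ := exists_measurableEmbedding_real Ω
  have hid : Measurable (id : (ℚ → ℝ) → ℚ → ℝ) := measurable_id
  refine ⟨fun a => ((stieltjesOfMeasurableRat id hid a).measure).map he.invFun,
    (Measure.measurable_map _ he.measurable_invFun).comp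
      (measurable_measure_stieltjesOfMeasurableRat hid),
    fun a => Measure.isProbabilityMeasure_map he.measurable_invFun.aemeasurable, fun p hp => ?_⟩
  have := Measure.isProbabilityMeasure_map (μ := p) he.measurable.aemeasurable
  have hpt : IsRatStieltjesPoint (id : (ℚ → ℝ) → ℚ → ℝ) (fun r => cdf (p.map e) r) := by
    refine ⟨fun a b hab => monotone_cdf _ (by exact_mod_cast hab), ?_, ?_, fun t => ?_⟩
    · exact (tendsto_cdf_atTop _).comp (tendsto_ratCast_atTop_iff.2 tendsto_id)
    · exact (tendsto_cdf_atBot _).comp (tendsto_ratCast_atBot_iff.2 tendsto_id)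
    · refine Eq.trans ?_ ((cdf (p.map e)).iInf_rat_gt_eq (t : ℝ))
      refine Equiv.iInf_congr (Equiv.subtypeEquivRight fun s => ?_) fun s => rfl
      simp
  refine ⟨fun r => cdf (p.map e) r, ?_⟩
  have h : (stieltjesOfMeasurableRat id hid (fun r => cdf (p.map e) r)).measure = p.map e := by
    refine ext_of_generate_finite _ Real.borel_eq_generateFrom_Iic_rat Real.isPiSystem_Iic_rat
      ?_ (by simp)
    intro s hs
    obtain ⟨r, rfl⟩ := Set.mem_iUnion.1 hs
    rw [measure_stieltjesOfMeasurableRat_Iic, stieltjesOfMeasurableRat_eq,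
      toRatCDF_of_isRatStieltjesPoint hpt, id, ofReal_cdf]
  simp only [h]
  rw [Measure.map_map he.measurable_invFun he.measurable]
  convert Measure.map_id
  ext x
  exact he.leftInverse_invFun x

lemma nonempty_of_isProbabilityMeasure {Y : Type*} [MeasurableSpace Y] (p : ProbabilityMeasure Y) :
    Nonempty Y :=
  (p : Measure Y).nonempty_of_neZero

variable {Y : Type*} [TopologicalSpace Y] [PolishSpace Y] [MeasurableSpace Y] [BorelSpace Y]

lemma exists_measurable_surjective_probabilityMeasure (Y : Type*) [TopologicalSpace Y]
    [PolishSpace Y] [MeasurableSpace Y] [BorelSpace Y] [Nonempty Y] :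
    ∃ T : (ℚ → ℝ) → ProbabilityMeasure Y, Measurable T ∧ Function.Surjective T := by
  obtain ⟨T, hT, hp, hs⟩ := exists_measurable_surjective_prob Y
  refine ⟨fun a => ⟨T a, hp a⟩, measurable_of_measurable_toMeasure hT, fun p => ?_⟩
  obtain ⟨a, ha⟩ := hs p p.2
  exact ⟨a, Subtype.ext ha⟩

/-- Borel sets of pairs `(z, p)` with `p` a probability measure are analytic. -/
lemma analyticSet_of_measurableSet_prod {Z : Type*} [TopologicalSpace Z] [PolishSpace Z]
    [MeasurableSpace Z] [BorelSpace Z] {S : Set (Z × ProbabilityMeasure Y)}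
    (hS : MeasurableSet S) : AnalyticSet S := by
  rcases isEmpty_or_nonempty Y with hY | hY
  · have : S = ∅ := Set.eq_empty_of_forall_notMem fun z =>
      (not_isEmpty_iff.2 (nonempty_of_isProbabilityMeasure z.2)) hY |>.elim
    exact this ▸ analyticSet_empty
  obtain ⟨T, hT, hs⟩ := exists_measurable_surjective_probabilityMeasure Y
  have hT' : Measurable (Prod.map id T : Z × (ℚ → ℝ) → Z × ProbabilityMeasure Y) :=
    measurable_id.prodMap hT
  rw [← Set.image_preimage_eq S (Function.surjective_id.prodMap hs)]
  exact (hT' hS).analyticSet_image hT'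

lemma analyticSet_of_measurableSet {S : Set (ProbabilityMeasure Y)} (hS : MeasurableSet S) :
    AnalyticSet S := by
  have := analyticSet_of_measurableSet_prod (Z := Unit) (measurable_snd hS)
  convert this.image_of_continuous continuous_snd
  ext p
  simp

lemma measure_eq_one_of_subset {Z : Type*} [MeasurableSpace Z] {μ : Measure Z}
    [IsProbabilityMeasure μ] {s : Set Z} (h : ∀ t, MeasurableSet t → s ⊆ t → μ t = 1) :
    μ s = 1 := by
  rw [← measure_toMeasurable]
  exact h _ (measurableSet_toMeasurable _ _) (subset_toMeasurable _ _)

/-- The probability measures carried by an analytic set form an analytic set. -/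
lemma analyticSet_setOf_prob_eq_one {A : Set Y} (hA : AnalyticSet A) :
    AnalyticSet {p : ProbabilityMeasure Y | (p : Measure Y) A = 1} := by
  rw [AnalyticSet] at hA
  rcases hA with rfl | ⟨f, hf, rfl⟩
  · simp [analyticSet_empty]
  obtain ⟨T, hT, hs⟩ := exists_measurable_surjective_probabilityMeasure (ℕ → ℕ)
  obtain ⟨σ, hσ, hfσ⟩ := exists_section_of_continuous hf
  have hF : Measurable fun a => (T a).map hf.measurable.aemeasurable :=
    measurable_of_measurable_toMeasure
      ((Measure.measurable_map _ hf.measurable).comp (measurable_toMeasure.comp hT))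
  convert MeasurableSet.univ.analyticSet_image hF
  ext p
  simp only [Set.mem_ofPred_eq, Set.image_univ, Set.mem_range]
  constructor
  · intro hp
    have hσp := aemeasurable_of_univSigma hσ (p : Measure Y)
    obtain ⟨a, ha⟩ := hs (p.map hσp)
    refine ⟨a, Subtype.ext ?_⟩
    rw [ha]
    change ((p : Measure Y).map σ).map f = p
    rw [AEMeasurable.map_map_of_aemeasurable hf.measurable.aemeasurable hσp]
    have : f ∘ σ =ᵐ[(p : Measure Y)] id := by
      have hn : NullMeasurableSet (Set.range f) (p : Measure Y) :=
        universallyMeasurableSet_of_analyticSet (analyticSet_range_of_polishSpace hf) _ p.2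
      filter_upwards [(prob_compl_eq_zero_iff₀ hn).2 hp] with y hy using hfσ y hy
    rw [Measure.map_congr this, Measure.map_id]
  · rintro ⟨a, rfl⟩
    refine measure_eq_one_of_subset fun t ht hst => ?_
    change ((T a : Measure _).map f) t = 1
    rw [Measure.map_apply hf.measurable ht, Set.preimage_eq_univ_iff.2 hst, measure_univ]

end AnalyticProb

section OneStep

variable {X A1 A2 Z : Type*} [MeasurableSpace X] [MeasurableSpace A1] [MeasurableSpace A2]
  [MeasurableSpace Z] {n : ℕ}

/-- The history obtained from `h` by appending the actions `a` and the next state `y`. -/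
def extM (h : HistM X A1 A2 n) (a : A1 × A2) (y : X) : HistM X A1 A2 (n + 1) :=
  (Fin.snoc h.1 (h.2, a), y)

/-- The initial segment of length `n` of a history of length `n + 1`. -/
def initM (h : HistM X A1 A2 (n + 1)) : HistM X A1 A2 n :=
  (fun i => h.1 i.castSucc, (h.1 (Fin.last n)).1)

/-- The last actions in a history of length `n + 1`. -/
def lastActM (h : HistM X A1 A2 (n + 1)) : A1 × A2 := (h.1 (Fin.last n)).2

/-- The history up to time `n` of a trajectory. -/
def hProjM (n : ℕ) (ω : TrajM X A1 A2) : HistM X A1 A2 n := (fun i => ω i, (ω n).1)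

/-- The initial state contained in an information vector. -/
def firstM : ∀ {n : ℕ}, InfoM X A1 n → X
  | 0, i => i.2
  | _ + 1, i => (i.1 0).1

omit [MeasurableSpace X] [MeasurableSpace A1] [MeasurableSpace A2] in
lemma initM_extM (h : HistM X A1 A2 n) (a : A1 × A2) (y : X) : initM (extM h a y) = h := by
  simp [initM, extM]

omit [MeasurableSpace X] [MeasurableSpace A1] [MeasurableSpace A2] in
lemma lastActM_extM (h : HistM X A1 A2 n) (a : A1 × A2) (y : X) : lastActM (extM h a y) = a := by
  simp [lastActM, extM]

omit [MeasurableSpace X] [MeasurableSpace A1] [MeasurableSpace A2] in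
lemma firstM_iProjM (n : ℕ) (ω : TrajM X A1 A2) : firstM (iProjM n ω) = (ω 0).1 := by
  cases n <;> rfl

lemma measurable_extM : Measurable fun z : HistM X A1 A2 n × (A1 × A2) × X =>
    extM z.1 z.2.1 z.2.2 := by
  refine Measurable.prodMk (measurable_pi_lambda _ fun i => ?_) (by fun_prop)
  refine Fin.lastCases ?_ (fun j => ?_) i
  · simp only [Fin.snoc_last]; fun_prop
  · simp only [Fin.snoc_castSucc]; fun_prop

lemma measurable_initM : Measurable (initM : HistM X A1 A2 (n + 1) → HistM X A1 A2 n) := by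
  unfold initM; fun_prop

lemma measurable_lastActM : Measurable (lastActM : HistM X A1 A2 (n + 1) → A1 × A2) := by
  unfold lastActM; fun_prop

lemma measurable_infoM : Measurable (infoM : HistM X A1 A2 n → InfoM X A1 n) := by
  unfold infoM; fun_prop

lemma measurable_hProjM (n : ℕ) :
    Measurable (hProjM n : TrajM X A1 A2 → HistM X A1 A2 n) := by
  unfold hProjM; fun_prop

lemma measurable_iProjM (n : ℕ) :
    Measurable (iProjM n : TrajM X A1 A2 → InfoM X A1 n) := by
  unfold iProjM; fun_prop

lemma measurable_firstM : Measurable (firstM : InfoM X A1 n → X) := by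
  cases n
  · exact measurable_snd
  · unfold firstM; fun_prop

/-- The one-step conditional expectation operator of the model. -/
def stepInt (q : Kernel (X × A1 × A2) X) (k1 : InfoM X A1 n → Measure A1)
    (k2 : HistM X A1 A2 n → Measure A2) (g : HistM X A1 A2 (n + 1) → ℝ≥0∞)
    (h : HistM X A1 A2 n) : ℝ≥0∞ :=
  ∫⁻ a1, ∫⁻ a2, ∫⁻ y, g (extM h (a1, a2) y) ∂(q (h.2, a1, a2)) ∂(k2 h) ∂(k1 (infoM h))

lemma histIntM_succ (p0 : Measure X) (q : Kernel (X × A1 × A2) X)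
    (ν1 : ∀ n : ℕ, InfoM X A1 n → Measure A1) (ν2 : ∀ n : ℕ, HistM X A1 A2 n → Measure A2)
    (g : HistM X A1 A2 (n + 1) → ℝ≥0∞) :
    histIntM p0 q ν1 ν2 (n + 1) g = histIntM p0 q ν1 ν2 n (stepInt q (ν1 n) (ν2 n) g) := rfl

/-- The kernel on actions and next states given a parameter and a history. -/
def actStateKer (q : Kernel (X × A1 × A2) X) (K1 : Kernel (Z × InfoM X A1 n) A1)
    (K2 : Kernel (Z × HistM X A1 A2 n) A2) :
    Kernel (Z × HistM X A1 A2 n) ((A1 × A2) × X) :=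
  (K1.comap (fun zh => (zh.1, infoM zh.2))
      (measurable_fst.prodMk (measurable_infoM.comp measurable_snd)) ×ₖ K2) ⊗ₖ
    q.comap (fun zha => (zha.1.2.2, zha.2)) (by fun_prop)

/-- The one-step transition kernel on histories. -/
def stepKer (q : Kernel (X × A1 × A2) X) (K1 : Kernel (Z × InfoM X A1 n) A1)
    (K2 : Kernel (Z × HistM X A1 A2 n) A2) :
    Kernel (Z × HistM X A1 A2 n) (HistM X A1 A2 (n + 1)) :=
  (Kernel.id ×ₖ actStateKer q K1 K2).map fun w => extM w.1.2 w.2.1 w.2.2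

lemma measurable_extM_snd : Measurable fun w : (Z × HistM X A1 A2 n) × (A1 × A2) × X =>
    extM w.1.2 w.2.1 w.2.2 :=
  measurable_extM.comp (((measurable_snd.comp measurable_fst)).prodMk measurable_snd)

variable (q : Kernel (X × A1 × A2) X) [IsMarkovKernel q]

instance (K1 : Kernel (Z × InfoM X A1 n) A1) [IsMarkovKernel K1]
    (K2 : Kernel (Z × HistM X A1 A2 n) A2) [IsMarkovKernel K2] :
    IsMarkovKernel (actStateKer q K1 K2) := by
  unfold actStateKer; infer_instance

instance (K1 : Kernel (Z × InfoM X A1 n) A1) [IsMarkovKernel K1]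
    (K2 : Kernel (Z × HistM X A1 A2 n) A2) [IsMarkovKernel K2] :
    IsMarkovKernel (stepKer q K1 K2) :=
  Kernel.IsMarkovKernel.map _ measurable_extM_snd

lemma lintegral_stepKer (K1 : Kernel (Z × InfoM X A1 n) A1) [IsMarkovKernel K1]
    (K2 : Kernel (Z × HistM X A1 A2 n) A2) [IsMarkovKernel K2]
    {g : HistM X A1 A2 (n + 1) → ℝ≥0∞} (hg : Measurable g) (z : Z) (h : HistM X A1 A2 n) :
    ∫⁻ h', g h' ∂(stepKer q K1 K2 (z, h)) =
      stepInt q (fun i => K1 (z, i)) (fun h => K2 (z, h)) g h := by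
  have hg' : Measurable fun w : (Z × HistM X A1 A2 n) × (A1 × A2) × X =>
      g (extM w.1.2 w.2.1 w.2.2) := hg.comp measurable_extM_snd
  have hg2 : Measurable fun b : (A1 × A2) × X => g (extM h b.1 b.2) :=
    hg.comp (measurable_extM.comp (measurable_const.prodMk measurable_id))
  rw [stepKer, Kernel.lintegral_map _ measurable_extM_snd _ hg, Kernel.lintegral_id_prod hg',
    actStateKer, Kernel.lintegral_compProd _ _ _ hg2, Kernel.lintegral_prod]
  · rfl
  · refine Measurable.lintegral_kernel_prod_right (κ := q.comap (fun a => (h.2, a)) (by fun_prop)) ?_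
    exact hg2

/-- The law of `h_{n+1}` is obtained from the law of `h_n` by one step of the model with the
given conditional action distributions. -/
def IsStepM (k1 : InfoM X A1 n → Measure A1) (k2 : HistM X A1 A2 n → Measure A2)
    (P : Measure (HistM X A1 A2 n)) (P' : Measure (HistM X A1 A2 (n + 1))) : Prop :=
  ∀ g : HistM X A1 A2 (n + 1) → ℝ≥0∞, Measurable g → ∫⁻ h, g h ∂P' = ∫⁻ h, stepInt q k1 k2 g h ∂P

lemma isStepM_iff (K1 : Kernel (Z × InfoM X A1 n) A1) [IsMarkovKernel K1]
    (K2 : Kernel (Z × HistM X A1 A2 n) A2) [IsMarkovKernel K2] (z : Z)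
    (P : Measure (HistM X A1 A2 n)) (P' : Measure (HistM X A1 A2 (n + 1))) :
    IsStepM q (fun i => K1 (z, i)) (fun h => K2 (z, h)) P P' ↔
      P' = ((stepKer q K1 K2).sectR z) ∘ₘ P := by
  have key : ∀ g : HistM X A1 A2 (n + 1) → ℝ≥0∞, Measurable g →
      ∫⁻ h, g h ∂(((stepKer q K1 K2).sectR z) ∘ₘ P) =
        ∫⁻ h, stepInt q (fun i => K1 (z, i)) (fun h => K2 (z, h)) g h ∂P := fun g hg => by
    rw [Measure.lintegral_bind (Kernel.measurable _).aemeasurable hg.aemeasurable]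
    exact lintegral_congr fun h => by rw [Kernel.sectR_apply, lintegral_stepKer q K1 K2 hg]
  refine ⟨fun H => Measure.ext_of_lintegral _ fun g hg => ?_, fun H g hg => ?_⟩
  · rw [H g hg, key g hg]
  · rw [H, key g hg]

section Fixed

variable {q} (K1 : Kernel (InfoM X A1 n) A1) [IsMarkovKernel K1]
    (K2 : Kernel (HistM X A1 A2 n) A2) [IsMarkovKernel K2]

lemma isStepM_iff_measure (P : Measure (HistM X A1 A2 n)) (P' : Measure (HistM X A1 A2 (n + 1)))
    [IsProbabilityMeasure P] [IsProbabilityMeasure P'] :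
    IsStepM q K1 K2 P P' ↔ ∀ B, MeasurableSet B →
      P' B = ∫⁻ h, stepInt q K1 K2 (B.indicator fun _ => 1) h ∂P := by
  refine ⟨fun H B hB => ?_, fun H => ?_⟩
  · rw [← H _ (measurable_const.indicator hB), lintegral_indicator_const hB, one_mul]
  · have h1 := isStepM_iff q (K1.comap Prod.snd measurable_snd) (K2.comap Prod.snd measurable_snd)
      () P P'
    have h2 := isStepM_iff q (K1.comap Prod.snd measurable_snd) (K2.comap Prod.snd measurable_snd)
      () P _ |>.2 rfl
    refine h1.2 (Measure.ext fun B hB => ?_)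
    rw [H B hB, ← one_mul ((_ : Measure _) B), ← lintegral_indicator_const hB,
      h2 _ (measurable_const.indicator hB)]
    rfl

lemma measurable_stepInt {g : HistM X A1 A2 (n + 1) → ℝ≥0∞} (hg : Measurable g) :
    Measurable (stepInt q K1 K2 g) := by
  have h := Measurable.lintegral_kernel (κ := (stepKer q (K1.comap Prod.snd measurable_snd)
    (K2.comap Prod.snd measurable_snd)).sectR ()) hg
  convert h using 1
  ext h
  rw [Kernel.sectR_apply, lintegral_stepKer q _ _ hg]
  rfl

/-- Functions that agree almost surely at time `n + 1` have almost surely the same one-step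
conditional expectation. -/
lemma stepInt_congr_ae {P : Measure (HistM X A1 A2 n)} {P' : Measure (HistM X A1 A2 (n + 1))}
    (H : IsStepM q K1 K2 P P') {g g' : HistM X A1 A2 (n + 1) → ℝ≥0∞} (hg : g =ᵐ[P'] g') :
    stepInt q K1 K2 g =ᵐ[P] stepInt q K1 K2 g' := by
  obtain ⟨N, hN, hNm, hN0⟩ := exists_measurable_superset_of_null hg
  have hi : Measurable (N.indicator (fun _ => (1 : ℝ≥0∞))) := measurable_const.indicator hNm
  have h0 := H _ hi
  rw [lintegral_indicator_const hNm, hN0, mul_zero, eq_comm,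
    lintegral_eq_zero_iff (measurable_stepInt K1 K2 hi)] at h0
  filter_upwards [h0] with h hh
  have hq : Measurable fun b : (A1 × A2) × X =>
      N.indicator (fun _ => (1 : ℝ≥0∞)) (extM h b.1 b.2) :=
    hi.comp (measurable_extM.comp (measurable_const.prodMk measurable_id))
  have hq1 : Measurable fun a : A1 × A2 =>
      ∫⁻ y, N.indicator (fun _ => (1 : ℝ≥0∞)) (extM h a y) ∂(q (h.2, a)) :=
    Measurable.lintegral_kernel_prod_right (κ := q.comap (fun a => (h.2, a)) (by fun_prop)) hq
  have hq2 : Measurable fun a1 : A1 =>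
      ∫⁻ a2, ∫⁻ y, N.indicator (fun _ => (1 : ℝ≥0∞)) (extM h (a1, a2) y) ∂(q (h.2, a1, a2)) ∂(K2 h) :=
    hq1.lintegral_prod_right'
  have e1 := (lintegral_eq_zero_iff hq2).1 hh
  refine lintegral_congr_ae ?_
  filter_upwards [e1] with a1 h1
  refine lintegral_congr_ae ?_
  filter_upwards [(lintegral_eq_zero_iff (hq1.comp measurable_prodMk_left)).1 h1] with a2 h2
  refine lintegral_congr_ae ?_
  filter_upwards [(lintegral_eq_zero_iff (hq.comp measurable_prodMk_left)).1 h2] with y h3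
  by_contra hne
  have : extM h (a1, a2) y ∈ N := hN hne
  simp [this] at h3

end Fixed

end OneStep

section HistInt

variable {X A1 A2 : Type*} [MeasurableSpace X] [MeasurableSpace A1] [MeasurableSpace A2] {n : ℕ}
  {q : Kernel (X × A1 × A2) X} [IsMarkovKernel q]
  {K1 : Kernel (InfoM X A1 n) A1} [IsMarkovKernel K1]
  {K2 : Kernel (HistM X A1 A2 n) A2} [IsMarkovKernel K2]
  {P : Measure (HistM X A1 A2 n)} {P' : Measure (HistM X A1 A2 (n + 1))}
  {p0 : Measure X} {ν1 : ∀ n : ℕ, InfoM X A1 n → Measure A1}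
  {ν2 : ∀ n : ℕ, HistM X A1 A2 n → Measure A2}

omit [IsMarkovKernel q] [IsMarkovKernel K1] [IsMarkovKernel K2] in
lemma stepInt_congr_kernel (h1 : ∀ᵐ h ∂P, ν1 n (infoM h) = K1 (infoM h))
    (h2 : ∀ᵐ h ∂P, ν2 n h = K2 h) (g : HistM X A1 A2 (n + 1) → ℝ≥0∞) :
    stepInt q (ν1 n) (ν2 n) g =ᵐ[P] stepInt q K1 K2 g := by
  filter_upwards [h1, h2] with h h1 h2
  simp only [stepInt, h1, h2]

lemma histIntM_succ_eq_lintegral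
    (hS : ∀ g, AEMeasurable g P → histIntM p0 q ν1 ν2 n g = ∫⁻ h, g h ∂P)
    (h1 : ∀ᵐ h ∂P, ν1 n (infoM h) = K1 (infoM h)) (h2 : ∀ᵐ h ∂P, ν2 n h = K2 h)
    (H : IsStepM q K1 K2 P P') (g : HistM X A1 A2 (n + 1) → ℝ≥0∞) (hg : AEMeasurable g P') :
    histIntM p0 q ν1 ν2 (n + 1) g = ∫⁻ h, g h ∂P' := by
  have e : stepInt q (ν1 n) (ν2 n) g =ᵐ[P] stepInt q K1 K2 (hg.mk g) :=
    (stepInt_congr_kernel h1 h2 g).trans (stepInt_congr_ae K1 K2 H hg.ae_eq_mk)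
  rw [histIntM_succ, hS _ ⟨_, measurable_stepInt K1 K2 hg.measurable_mk, e⟩, lintegral_congr_ae e,
    ← H _ hg.measurable_mk, lintegral_congr_ae hg.ae_eq_mk]

lemma isStepM_of_histIntM [IsProbabilityMeasure P] [IsProbabilityMeasure P']
    (hS : ∀ g, AEMeasurable g P → histIntM p0 q ν1 ν2 n g = ∫⁻ h, g h ∂P)
    (h1 : ∀ᵐ h ∂P, ν1 n (infoM h) = K1 (infoM h)) (h2 : ∀ᵐ h ∂P, ν2 n h = K2 h)
    (H : ∀ B, MeasurableSet B → P' B = histIntM p0 q ν1 ν2 (n + 1) (B.indicator fun _ => 1)) :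
    IsStepM q K1 K2 P P' := by
  refine (isStepM_iff_measure K1 K2 P P').2 fun B hB => ?_
  have e := stepInt_congr_kernel (q := q) h1 h2 (B.indicator fun _ => 1)
  rw [H B hB, histIntM_succ, hS _
    ⟨_, measurable_stepInt K1 K2 (measurable_const.indicator hB), e⟩, lintegral_congr_ae e]

omit [IsMarkovKernel q] in
lemma histIntM_zero_eq_lintegral {P : Measure (HistM X A1 A2 0)}
    (hP : P = p0.map fun x => (Fin.elim0, x)) (g : HistM X A1 A2 0 → ℝ≥0∞)
    (hg : AEMeasurable g P) : histIntM p0 q ν1 ν2 0 g = ∫⁻ h, g h ∂P := by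
  subst hP
  rw [lintegral_map' hg (by fun_prop)]
  rfl

lemma IsStepM.map_infoM [IsProbabilityMeasure P] (H : IsStepM q K1 K2 P P') :
    P'.map (fun h => (infoM (initM h), (lastActM h).1)) = P.map infoM ⊗ₘ K1 := by
  have hm : Measurable fun h : HistM X A1 A2 (n + 1) => (infoM (initM h), (lastActM h).1) :=
    (measurable_infoM.comp measurable_initM).prodMk (measurable_fst.comp measurable_lastActM)
  have := Measure.isProbabilityMeasure_map (μ := P)
    (measurable_infoM (X := X) (A1 := A1) (A2 := A2) (n := n)).aemeasurable
  refine Measure.ext_of_lintegral _ fun f hf => ?_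
  rw [lintegral_map hf hm, H (fun h => f _) (hf.comp hm), Measure.lintegral_compProd hf,
    lintegral_map hf.lintegral_kernel_prod_right' measurable_infoM]
  simp [stepInt, initM_extM, lastActM_extM]

lemma IsStepM.map_hist [IsProbabilityMeasure P] (H : IsStepM q K1 K2 P P') :
    P'.map (fun h => (initM h, (lastActM h).2)) = P ⊗ₘ K2 := by
  have hm : Measurable fun h : HistM X A1 A2 (n + 1) => (initM h, (lastActM h).2) :=
    measurable_initM.prodMk (measurable_snd.comp measurable_lastActM)
  refine Measure.ext_of_lintegral _ fun f hf => ?_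
  rw [lintegral_map hf hm, H (fun h => f _) (hf.comp hm), Measure.lintegral_compProd hf]
  simp [stepInt, initM_extM, lastActM_extM]

end HistInt

section CondKernel

variable {Ω W A : Type*} [TopologicalSpace Ω] [MeasurableSpace Ω] [PolishSpace Ω] [BorelSpace Ω]
  [MeasurableSpace W] [MeasurableSpace.CountablyGenerated W]
  [MeasurableSpace A] [StandardBorelSpace A] [Nonempty A]

/-- The evaluation kernel from the space of probability measures. -/
def probKer (Ω : Type*) [TopologicalSpace Ω] [MeasurableSpace Ω] [PolishSpace Ω] [BorelSpace Ω] :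
    Kernel (ProbabilityMeasure Ω) Ω where
  toFun p := p
  measurable' := measurable_toMeasure

instance : IsMarkovKernel (probKer Ω) := ⟨fun p => p.2⟩

/-- The conditional law of `(w, a)` under `p` given `w`, jointly measurable in `p` and `w`. -/
def condKerP (w : Ω → W) (a : Ω → A) : Kernel (ProbabilityMeasure Ω × W) A :=
  ((probKer Ω).map fun ω => (w ω, a ω)).condKernel

variable {w : Ω → W} {a : Ω → A}

instance : IsMarkovKernel (condKerP w a) := by unfold condKerP; infer_instance

lemma map_prod_eq_compProd_condKerP (hw : Measurable w) (ha : Measurable a)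
    (p : ProbabilityMeasure Ω) :
    (p : Measure Ω).map (fun ω => (w ω, a ω)) =
      (p : Measure Ω).map w ⊗ₘ (condKerP w a).sectR p := by
  have hm := hw.prodMk ha
  have h := ((probKer Ω).map fun ω => (w ω, a ω)).disintegrate
    ((probKer Ω).map fun ω => (w ω, a ω)).condKernel
  have h2 := DFunLike.congr_fun h p
  change (((probKer Ω).map fun ω => (w ω, a ω)).fst ⊗ₖ condKerP w a) p = _ at h2
  rw [Kernel.compProd_apply_eq_compProd_sectR, Kernel.map_apply _ hm, Kernel.fst_apply,
    Kernel.map_apply _ hm, Measure.map_map measurable_fst hm] at h2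
  exact h2.symm

lemma ae_eq_condKerP (hw : Measurable w) (ha : Measurable a) (p : ProbabilityMeasure Ω)
    (K : Kernel W A) [IsMarkovKernel K]
    (h : (p : Measure Ω).map (fun ω => (w ω, a ω)) = (p : Measure Ω).map w ⊗ₘ K) :
    ∀ᵐ i ∂(p : Measure Ω).map w, K i = condKerP w a (p, i) := by
  have := Measure.isProbabilityMeasure_map (μ := (p : Measure Ω)) hw.aemeasurable
  have := Kernel.ae_eq_of_compProd_eq (h.symm.trans (map_prod_eq_compProd_condKerP hw ha p))
  filter_upwards [this] with i hi
  rw [hi, Kernel.sectR_apply]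

end CondKernel

section Policies

variable {W A X : Type*} {Acts : X → Set A} {st : W → X}

/-- The set of pairs of an observation and an admissible action. -/
def admSet (Acts : X → Set A) (st : W → X) : Set (W × A) := {wa | wa.2 ∈ Acts (st wa.1)}

lemma analyticSet_admSet [TopologicalSpace W] [PolishSpace W] [TopologicalSpace A]
    [PolishSpace A] [TopologicalSpace X] [PolishSpace X]
    (hΓ : AnalyticSet {xa : X × A | xa.2 ∈ Acts xa.1}) (hst : Continuous st) :
    AnalyticSet (admSet Acts st) :=
  hΓ.preimage (f := fun wa : W × A => (st wa.1, wa.2)) (by fun_prop)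

lemma ae_measure_eq_one_of_ae_mem [MeasurableSpace W] [MeasurableSpace A] {μ : Measure W}
    [IsProbabilityMeasure μ] {K : Kernel W A} [IsMarkovKernel K]
    (h : ∀ᵐ wa ∂(μ ⊗ₘ K), wa ∈ admSet Acts st) :
    ∀ᵐ w ∂μ, K w (Acts (st w)) = 1 := by
  filter_upwards [Measure.ae_ae_of_ae_compProd h] with w hw
  have : Acts (st w) =ᵐ[K w] Set.univ := eventuallyEq_univ.2 hw
  rw [measure_congr this, measure_univ]

variable [TopologicalSpace W] [PolishSpace W] [MeasurableSpace W] [BorelSpace W]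
  [TopologicalSpace A] [PolishSpace A] [MeasurableSpace A] [BorelSpace A]
  [TopologicalSpace X] [PolishSpace X] [MeasurableSpace X] [BorelSpace X]

omit [TopologicalSpace W] [PolishSpace W] [BorelSpace W] in
/-- A universally measurable stochastic kernel agrees almost everywhere with a Borel one. -/
lemma exists_kernel_ae_eq {ν : W → Measure A} (hp : ∀ w, IsProbabilityMeasure (ν w))
    (hu : ∀ B, MeasurableSet B → UniversallyMeasurable fun w => ν w B)
    (μ : Measure W) [IsProbabilityMeasure μ] :
    ∃ K : Kernel W A, IsMarkovKernel K ∧ ∀ᵐ w ∂μ, ν w = K w := by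
  let g : W → ProbabilityMeasure A := fun w => ⟨ν w, hp w⟩
  have hg : Measurable[univSigma W] g :=
    @measurable_of_measurable_toMeasure A _ _ _ _ _ W (univSigma W) _
      (@Measure.measurable_of_measurable_coe A W _ (univSigma W) _ fun B hB => hu B hB)
  have hg' := aemeasurable_of_univSigma hg μ
  refine ⟨⟨fun w => hg'.mk _ w, measurable_toMeasure.comp hg'.measurable_mk⟩,
    ⟨fun w => (hg'.mk _ w).2⟩, ?_⟩
  filter_upwards [hg'.ae_eq_mk] with w hw
  exact congrArg ProbabilityMeasure.toMeasure hw

omit [MeasurableSpace X] [BorelSpace X] in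
lemma ae_mem_of_ae_measure_eq_one (hΓ : AnalyticSet {xa : X × A | xa.2 ∈ Acts xa.1})
    (hst : Continuous st) {μ : Measure W} [IsProbabilityMeasure μ] {K : Kernel W A}
    [IsMarkovKernel K] (h : ∀ᵐ w ∂μ, K w (Acts (st w)) = 1) :
    ∀ᵐ wa ∂(μ ⊗ₘ K), wa ∈ admSet Acts st := by
  have hn := universallyMeasurableSet_of_analyticSet (analyticSet_admSet hΓ hst) (μ ⊗ₘ K)
    inferInstance
  obtain ⟨N, hN, hNm, hNe⟩ := hn.compl.exists_measurable_subset_ae_eq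
  rw [ae_iff]
  change (μ ⊗ₘ K) (admSet Acts st)ᶜ = 0
  rw [← measure_congr hNe, Measure.compProd_apply hNm]
  refine (lintegral_congr_ae (g := 0) ?_).trans lintegral_zero
  filter_upwards [h] with w hw
  have hs := measurable_prodMk_left (x := w) hNm
  refine (prob_compl_eq_one_iff hs).1 (le_antisymm prob_le_one (hw.symm.le.trans (measure_mono ?_)))
  exact fun a ha haN => hN haN ha

/-- Realization of a parametrized stochastic kernel by a universally measurable kernel carried by
the admissible actions. -/
lemma exists_policy {T : Type*} [MeasurableSpace T] [MeasurableSpace.CountablyGenerated T]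
    (hne : ∀ x, (Acts x).Nonempty)
    (hΓ : AnalyticSet {xa : X × A | xa.2 ∈ Acts xa.1}) (hst : Continuous st)
    (κ : Kernel (T × W) A) [IsMarkovKernel κ] {φ : W → T} (hφ : Measurable[univSigma W] φ) :
    ∃ ν : W → Measure A, (∀ w, IsProbabilityMeasure (ν w)) ∧
      (∀ B, MeasurableSet B → UniversallyMeasurable fun w => ν w B) ∧
      (∀ w, ν w (Acts (st w)) = 1) ∧
      ∀ w, κ (φ w, w) (Acts (st w)) = 1 → ν w = κ (φ w, w) := by
  classical
  obtain ⟨s, hs, hsA⟩ := exists_universally_measurable_selection hne hΓ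
  refine ⟨fun w => if κ (φ w, w) (Acts (st w)) = 1 then κ (φ w, w) else Measure.dirac (s (st w)),
    fun w => ?_, fun B hB S hS μ hμ => ?_, fun w => ?_, fun w hw => if_pos hw⟩
  · dsimp only
    split_ifs <;> infer_instance
  · refine (AEMeasurable.nullMeasurable ?_) hS
    have hφ' := aemeasurable_of_univSigma hφ μ
    have hs' := aemeasurable_of_univSigma
      (@Measurable.comp _ _ _ (univSigma W) (univSigma X) _ _ _ hs
        (measurable_univSigma_univSigma hst.measurable)) μ
    let κ' : Kernel W A := κ.comap (fun w => (hφ'.mk φ w, w)) (by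
      exact hφ'.measurable_mk.prodMk measurable_id)
    have hn := universallyMeasurableSet_of_analyticSet (analyticSet_admSet hΓ hst) (μ ⊗ₘ κ')
      inferInstance
    obtain ⟨M, -, hM, hMe⟩ := hn.exists_measurable_subset_ae_eq
    have hsec : ∀ᵐ w ∂μ, κ' w (Acts (st w)) = κ' w (Prod.mk w ⁻¹' M) := by
      filter_upwards [Measure.ae_ae_of_ae_compProd hMe] with w hw
      exact (measure_congr hw).symm
    refine ⟨fun w => if κ' w (Prod.mk w ⁻¹' M) = 1 then κ' w B else
      B.indicator (fun _ => 1) (hs'.mk _ w), ?_, ?_⟩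
    · exact Measurable.ite (Kernel.measurable_kernel_prodMk_left hM (measurableSet_singleton 1))
        (Kernel.measurable_coe _ hB) ((measurable_const.indicator hB).comp hs'.measurable_mk)
    · filter_upwards [hφ'.ae_eq_mk, hs'.ae_eq_mk, hsec] with w h1 h2 h3
      have e : κ (φ w, w) = κ' w := by rw [Kernel.comap_apply, h1]
      rw [e, h3, ← h2]
      split_ifs
      · rfl
      · rw [Measure.dirac_apply' _ hB]; rfl
  · dsimp only
    split_ifs with h
    · exact h
    · refine measure_eq_one_of_subset fun t ht hst' => ?_
      rw [Measure.dirac_apply' _ ht, Set.indicator_of_mem (hst' (hsA _))]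
      rfl

end Policies

section Admissible

variable {Ω W A X : Type*} [TopologicalSpace Ω] [PolishSpace Ω] [MeasurableSpace Ω] [BorelSpace Ω]
  [TopologicalSpace W] [PolishSpace W] [MeasurableSpace W] [BorelSpace W]
  [TopologicalSpace A] [PolishSpace A] [MeasurableSpace A] [BorelSpace A] [Nonempty A]
  [TopologicalSpace X] [PolishSpace X] {Acts : X → Set A} {st : W → X}

/-- The actions are almost surely admissible if and only if the conditional distributions of the
actions are almost surely carried by the admissible actions. -/
lemma measure_adm_eq_one_iff (hΓ : AnalyticSet {xa : X × A | xa.2 ∈ Acts xa.1})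
    (hst : Continuous st) {w : Ω → W} {a : Ω → A} (hw : Measurable w) (ha : Measurable a)
    (p : ProbabilityMeasure Ω) :
    (p : Measure Ω) {ω | a ω ∈ Acts (st (w ω))} = 1 ↔
      ∀ᵐ i ∂(p : Measure Ω).map w, condKerP w a (p, i) (Acts (st i)) = 1 := by
  have hm := hw.prodMk ha
  have := Measure.isProbabilityMeasure_map (μ := (p : Measure Ω)) hw.aemeasurable
  have := Measure.isProbabilityMeasure_map (μ := (p : Measure Ω)) hm.aemeasurable
  have hn := universallyMeasurableSet_of_analyticSet (analyticSet_admSet hΓ hst)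
    ((p : Measure Ω).map fun ω => (w ω, a ω)) inferInstance
  have h1 : (p : Measure Ω) {ω | a ω ∈ Acts (st (w ω))} = 1 ↔
      ∀ᵐ wa ∂(p : Measure Ω).map (fun ω => (w ω, a ω)), wa ∈ admSet Acts st := by
    change (p : Measure Ω) ((fun ω => (w ω, a ω)) ⁻¹' admSet Acts st) = 1 ↔ _
    rw [← Measure.map_apply₀ hm.aemeasurable hn, ← prob_compl_eq_zero_iff₀ hn]
    rfl
  rw [h1, map_prod_eq_compProd_condKerP hw ha p]
  exact ⟨fun h => ae_measure_eq_one_of_ae_mem h, fun h =>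
    ae_mem_of_ae_measure_eq_one (K := (condKerP w a).sectR p) hΓ hst h⟩

omit [MeasurableSpace A] [BorelSpace A] [Nonempty A] in
lemma analyticSet_prob_adm (hΓ : AnalyticSet {xa : X × A | xa.2 ∈ Acts xa.1})
    {s : ℕ → Ω → X} {a : ℕ → Ω → A} (hs : ∀ n, Continuous (s n)) (ha : ∀ n, Continuous (a n)) :
    AnalyticSet
      {p : ProbabilityMeasure Ω | ∀ n, (p : Measure Ω) {ω | a n ω ∈ Acts (s n ω)} = 1} := by
  rw [Set.ofPred_forall]
  exact AnalyticSet.iInter fun n => analyticSet_setOf_prob_eq_one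
    (hΓ.preimage (f := fun ω => (s n ω, a n ω)) ((hs n).prodMk (ha n)))

omit [PolishSpace A] [Nonempty A] [PolishSpace X] in
lemma measurableSet_prob_adm [MeasurableSpace X] [BorelSpace X]
    (hΓ : MeasurableSet {xa : X × A | xa.2 ∈ Acts xa.1})
    {s : ℕ → Ω → X} {a : ℕ → Ω → A} (hs : ∀ n, Continuous (s n)) (ha : ∀ n, Continuous (a n)) :
    MeasurableSet
      {p : ProbabilityMeasure Ω | ∀ n, (p : Measure Ω) {ω | a n ω ∈ Acts (s n ω)} = 1} := by
  rw [Set.ofPred_forall]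
  refine MeasurableSet.iInter fun n => ?_
  have : MeasurableSet {ω | a n ω ∈ Acts (s n ω)} :=
    ((hs n).measurable.prodMk (ha n).measurable) hΓ
  exact ((Measure.measurable_coe this).comp measurable_toMeasure) (measurableSet_singleton 1)

end Admissible

/-- Shortcut instance for measurability of the diagonal. -/
instance instMeasurableEqProb {Ω : Type*} [TopologicalSpace Ω] [PolishSpace Ω] [MeasurableSpace Ω]
    [BorelSpace Ω] : MeasurableEq (ProbabilityMeasure Ω) :=
  instMeasurableEqOfSecondCountableTopologyOfT2Space

section Projections

variable {X A1 A2 : Type*} [MeasurableSpace X]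
  [MeasurableSpace A1] [MeasurableSpace A2]

lemma isProbabilityMeasure_map_hProjM (p : ProbabilityMeasure (TrajM X A1 A2)) (n : ℕ) :
    IsProbabilityMeasure ((p : Measure (TrajM X A1 A2)).map (hProjM n)) :=
  Measure.isProbabilityMeasure_map (measurable_hProjM n).aemeasurable

lemma map_infoM_map_hProjM (p : ProbabilityMeasure (TrajM X A1 A2)) (n : ℕ) :
    ((p : Measure (TrajM X A1 A2)).map (hProjM n)).map infoM =
      (p : Measure (TrajM X A1 A2)).map (iProjM n) :=
  Measure.map_map measurable_infoM (measurable_hProjM n)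

lemma map_hProjM_zero (p : ProbabilityMeasure (TrajM X A1 A2)) :
    (p : Measure (TrajM X A1 A2)).map (hProjM 0) =
      ((p : Measure (TrajM X A1 A2)).map fun ω => (ω 0).1).map fun x => (Fin.elim0, x) := by
  rw [Measure.map_map (by fun_prop) (by fun_prop)]
  exact congrArg (Measure.map · _) (funext fun ω => Prod.ext (Subsingleton.elim _ _) rfl)

end Projections

section Model

variable {X A1 A2 : Type*}
  [TopologicalSpace X] [PolishSpace X] [MeasurableSpace X] [BorelSpace X]
  [TopologicalSpace A1] [PolishSpace A1] [MeasurableSpace A1] [BorelSpace A1]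
  [TopologicalSpace A2] [PolishSpace A2] [MeasurableSpace A2] [BorelSpace A2]
  [Nonempty A1] [Nonempty A2]

/-- The conditional law of the `n`-th action of player 1 given the information vector. -/
def condKer1 (n : ℕ) :
    Kernel (ProbabilityMeasure (TrajM X A1 A2) × InfoM X A1 n) A1 :=
  condKerP (iProjM n) fun ω => (ω n).2.1

/-- The conditional law of the `n`-th action of player 2 given the history. -/
def condKer2 (n : ℕ) :
    Kernel (ProbabilityMeasure (TrajM X A1 A2) × HistM X A1 A2 n) A2 :=
  condKerP (hProjM n) fun ω => (ω n).2.2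

instance (n : ℕ) : IsMarkovKernel (condKer1 (X := X) (A1 := A1) (A2 := A2) n) := by
  unfold condKer1; infer_instance

instance (n : ℕ) : IsMarkovKernel (condKer2 (X := X) (A1 := A1) (A2 := A2) n) := by
  unfold condKer2; infer_instance

/-- The measures under which the players act independently given the information vector and the
history, and the states follow the transition kernel. -/
def stepSet (q : Kernel (X × A1 × A2) X) : Set (ProbabilityMeasure (TrajM X A1 A2)) :=
  {p | ∀ n, IsStepM q (fun i => condKer1 n (p, i)) (fun h => condKer2 n (p, h))
    ((p : Measure _).map (hProjM n)) ((p : Measure _).map (hProjM (n + 1)))}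

/-- The measures under which player 1 almost surely takes admissible actions. -/
def admSet1 (A2 : Type*) [TopologicalSpace A2] [MeasurableSpace A2] (Acts1 : X → Set A1) :
    Set (ProbabilityMeasure (TrajM X A1 A2)) :=
  {p | ∀ n, (p : Measure _) {ω : TrajM X A1 A2 | (ω n).2.1 ∈ Acts1 (ω n).1} = 1}

/-- The measures under which player 2 almost surely takes admissible actions. -/
def admSet2 (A1 : Type*) [TopologicalSpace A1] [MeasurableSpace A1] (Acts2 : X → Set A2) :
    Set (ProbabilityMeasure (TrajM X A1 A2)) :=
  {p | ∀ n, (p : Measure _) {ω : TrajM X A1 A2 | (ω n).2.2 ∈ Acts2 (ω n).1} = 1}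

lemma measurableSet_stepSet (q : Kernel (X × A1 × A2) X) [IsMarkovKernel q] :
    MeasurableSet (stepSet q) := by
  rw [stepSet, Set.ofPred_forall]
  refine MeasurableSet.iInter fun n => ?_
  let ρ (n : ℕ) : Kernel (ProbabilityMeasure (TrajM X A1 A2)) (HistM X A1 A2 n) :=
    (probKer _).map (hProjM n)
  have hρ (n : ℕ) : IsMarkovKernel (ρ n) := Kernel.IsMarkovKernel.map _ (measurable_hProjM n)
  let η : Kernel (ProbabilityMeasure (TrajM X A1 A2)) (HistM X A1 A2 (n + 1)) :=
    stepKer q (condKer1 n) (condKer2 n) ∘ₖ (Kernel.id ×ₖ ρ n)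
  have hη (p : ProbabilityMeasure (TrajM X A1 A2)) :
      η p = ((stepKer q (condKer1 n) (condKer2 n)).sectR p) ∘ₘ
        ((p : Measure (TrajM X A1 A2)).map (hProjM n)) := by
    refine Measure.ext_of_lintegral _ fun g hg => ?_
    rw [Measure.lintegral_bind (Kernel.measurable _).aemeasurable hg.aemeasurable,
      Kernel.lintegral_comp _ _ _ hg, Kernel.lintegral_id_prod hg.lintegral_kernel,
      Kernel.map_apply _ (measurable_hProjM n)]
    rfl
  let f : ProbabilityMeasure (TrajM X A1 A2) → ProbabilityMeasure (HistM X A1 A2 (n + 1)) :=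
    fun p => ⟨ρ (n + 1) p, inferInstance⟩
  let g : ProbabilityMeasure (TrajM X A1 A2) → ProbabilityMeasure (HistM X A1 A2 (n + 1)) :=
    fun p => ⟨η p, inferInstance⟩
  have hf : Measurable f := measurable_of_measurable_toMeasure (ρ (n + 1)).measurable
  have hg : Measurable g := measurable_of_measurable_toMeasure η.measurable
  have key := measurableSet_eq_fun hf hg
  convert key using 3 with p
  have hρp : ρ (n + 1) p = (p : Measure (TrajM X A1 A2)).map (hProjM (n + 1)) :=
    Kernel.map_apply _ (measurable_hProjM (n + 1)) _
  rw [isStepM_iff, ← hη, ← hρp]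
  exact (Subtype.ext_iff (a1 := f p) (a2 := g p)).symm

omit [Nonempty A2] in
lemma ae_eq_condKer1 {q : Kernel (X × A1 × A2) X} [IsMarkovKernel q] {n : ℕ}
    {K1 : Kernel (InfoM X A1 n) A1} [IsMarkovKernel K1]
    {K2 : Kernel (HistM X A1 A2 n) A2} [IsMarkovKernel K2]
    {p : ProbabilityMeasure (TrajM X A1 A2)}
    (H : IsStepM q K1 K2 ((p : Measure _).map (hProjM n)) ((p : Measure _).map (hProjM (n + 1)))) :
    ∀ᵐ i ∂(p : Measure (TrajM X A1 A2)).map (iProjM n), K1 i = condKer1 n (p, i) := by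
  have := isProbabilityMeasure_map_hProjM p n
  refine ae_eq_condKerP (measurable_iProjM n) (by fun_prop) p K1 ?_
  have h := H.map_infoM
  have hm : Measurable fun h : HistM X A1 A2 (n + 1) => (infoM (initM h), (lastActM h).1) :=
    (measurable_infoM.comp measurable_initM).prodMk (measurable_fst.comp measurable_lastActM)
  rw [map_infoM_map_hProjM, Measure.map_map hm (measurable_hProjM _)] at h
  exact h

omit [Nonempty A1] in
lemma ae_eq_condKer2 {q : Kernel (X × A1 × A2) X} [IsMarkovKernel q] {n : ℕ}
    {K1 : Kernel (InfoM X A1 n) A1} [IsMarkovKernel K1]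
    {K2 : Kernel (HistM X A1 A2 n) A2} [IsMarkovKernel K2]
    {p : ProbabilityMeasure (TrajM X A1 A2)}
    (H : IsStepM q K1 K2 ((p : Measure _).map (hProjM n)) ((p : Measure _).map (hProjM (n + 1)))) :
    ∀ᵐ h ∂(p : Measure (TrajM X A1 A2)).map (hProjM n), K2 h = condKer2 n (p, h) := by
  have := isProbabilityMeasure_map_hProjM p n
  refine ae_eq_condKerP (measurable_hProjM n) (by fun_prop) p K2 ?_
  have h := H.map_hist
  have hm : Measurable fun h : HistM X A1 A2 (n + 1) => (initM h, (lastActM h).2) :=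
    measurable_initM.prodMk (measurable_snd.comp measurable_lastActM)
  rw [Measure.map_map hm (measurable_hProjM _)] at h
  exact h

lemma mem_of_inducesM {q : Kernel (X × A1 × A2) X} [IsMarkovKernel q]
    {Acts1 : X → Set A1} {Acts2 : X → Set A2}
    (hΓ1 : AnalyticSet {xa : X × A1 | xa.2 ∈ Acts1 xa.1})
    (hΓ2 : AnalyticSet {xa : X × A2 | xa.2 ∈ Acts2 xa.1})
    {π1 : Policy1 Acts1} {π2 : Policy2 A1 Acts2} {p0 : Measure X}
    {p : ProbabilityMeasure (TrajM X A1 A2)} (H : InducesM q π1 π2 p0 p) :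
    p ∈ stepSet q ∩ (admSet1 A2 Acts1 ∩ admSet2 A1 Acts2) := by
  have hP := isProbabilityMeasure_map_hProjM p
  have hI (n : ℕ) : IsProbabilityMeasure ((p : Measure (TrajM X A1 A2)).map (iProjM n)) :=
    Measure.isProbabilityMeasure_map (measurable_iProjM n).aemeasurable
  have H' (n : ℕ) (B : Set (HistM X A1 A2 n)) (hB : MeasurableSet B) :
      (p : Measure (TrajM X A1 A2)).map (hProjM n) B =
        histIntM p0 q π1.μ π2.μ n (B.indicator fun _ => 1) := by
    rw [← H n B hB, Measure.map_apply (measurable_hProjM n) hB]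
    rfl
  choose K1 hK1 hν1 using fun n => exists_kernel_ae_eq (π1.isProb n) (π1.umeas n)
    ((p : Measure (TrajM X A1 A2)).map (iProjM n))
  choose K2 hK2 hν2 using fun n => exists_kernel_ae_eq (π2.isProb n) (π2.umeas n)
    ((p : Measure (TrajM X A1 A2)).map (hProjM n))
  have hν1' (n : ℕ) : ∀ᵐ h ∂(p : Measure (TrajM X A1 A2)).map (hProjM n),
      π1.μ n (infoM h) = K1 n (infoM h) :=
    ae_of_ae_map measurable_infoM.aemeasurable ((map_infoM_map_hProjM p n).symm ▸ hν1 n)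
  have hS (n : ℕ) : ∀ g, AEMeasurable g ((p : Measure (TrajM X A1 A2)).map (hProjM n)) →
      histIntM p0 q π1.μ π2.μ n g = ∫⁻ h, g h ∂(p : Measure (TrajM X A1 A2)).map (hProjM n) := by
    induction n with
    | zero =>
      refine histIntM_zero_eq_lintegral (Measure.ext fun B hB => ?_)
      rw [H' 0 B hB, Measure.map_apply (by fun_prop) hB, ← lintegral_indicator_one
        (hB.preimage (by fun_prop))]
      rfl
    | succ n ih =>
      exact histIntM_succ_eq_lintegral ih (hν1' n) (hν2 n)
        (isStepM_of_histIntM ih (hν1' n) (hν2 n) (H' (n + 1)))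
  have hstep (n : ℕ) := isStepM_of_histIntM (hS n) (hν1' n) (hν2 n) (H' (n + 1))
  have e1 (n : ℕ) := ae_eq_condKer1 (hstep n)
  have e2 (n : ℕ) := ae_eq_condKer2 (hstep n)
  refine ⟨fun n g hg => ?_, fun n => ?_, fun n => ?_⟩
  · rw [hstep n g hg]
    refine lintegral_congr_ae ?_
    filter_upwards [e2 n, ae_of_ae_map (μ := (p : Measure (TrajM X A1 A2)).map (hProjM n))
      measurable_infoM.aemeasurable ((map_infoM_map_hProjM p n).symm ▸ e1 n)] with h h2 h1
    simp only [stepInt, h1, h2]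
  · refine (measure_adm_eq_one_iff hΓ1 continuous_snd (measurable_iProjM n) (by fun_prop) p).2 ?_
    filter_upwards [e1 n, hν1 n] with i h1 h2
    change condKer1 n (p, i) (Acts1 i.2) = 1
    rw [← h1, ← h2, π1.feasible]
  · refine (measure_adm_eq_one_iff hΓ2 continuous_snd (measurable_hProjM n) (by fun_prop) p).2 ?_
    filter_upwards [e2 n, hν2 n] with i h1 h2
    change condKer2 n (p, i) (Acts2 i.2) = 1
    rw [← h1, ← h2, π2.feasible]

/-- Simultaneous realization by policies of a universally measurable family of measures that is
almost surely determined by the initial state. -/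
lemma exists_policies_inducesM {q : Kernel (X × A1 × A2) X} [IsMarkovKernel q]
    {Acts1 : X → Set A1} {Acts2 : X → Set A2}
    (hne1 : ∀ x, (Acts1 x).Nonempty) (hne2 : ∀ x, (Acts2 x).Nonempty)
    (hΓ1 : AnalyticSet {xa : X × A1 | xa.2 ∈ Acts1 xa.1})
    (hΓ2 : AnalyticSet {xa : X × A2 | xa.2 ∈ Acts2 xa.1})
    {ξ : X → ProbabilityMeasure (TrajM X A1 A2)} (hξ : Measurable[univSigma X] ξ)
    (hmem : ∀ x, ξ x ∈ stepSet q ∩ (admSet1 A2 Acts1 ∩ admSet2 A1 Acts2))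
    (hfix : ∀ x, ∀ᵐ y ∂(ξ x : Measure (TrajM X A1 A2)).map (fun ω => (ω 0).1), ξ y = ξ x) :
    ∃ (π1 : Policy1 Acts1) (π2 : Policy2 A1 Acts2), ∀ x,
      InducesM q π1 π2 ((ξ x : Measure (TrajM X A1 A2)).map fun ω => (ω 0).1) (ξ x) := by
  have hφ1 (n : ℕ) : Measurable[univSigma (InfoM X A1 n)] fun i : InfoM X A1 n => ξ (firstM i) :=
    @Measurable.comp _ _ _ (univSigma _) (univSigma X) _ _ _ hξ
      (measurable_univSigma_univSigma measurable_firstM)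
  have hφ2 (n : ℕ) : Measurable[univSigma (HistM X A1 A2 n)]
      fun h : HistM X A1 A2 n => ξ (firstM (infoM h)) :=
    @Measurable.comp _ _ _ (univSigma _) (univSigma X) _ _ _ hξ
      (measurable_univSigma_univSigma (measurable_firstM.comp measurable_infoM))
  choose ν1 hp1 hu1 hf1 he1 using fun n => exists_policy hne1 hΓ1
    (continuous_snd (X := Fin n → X × A1)) (condKer1 (A2 := A2) n) (hφ1 n)
  choose ν2 hp2 hu2 hf2 he2 using fun n => exists_policy hne2 hΓ2
    (continuous_snd (X := Fin n → X × A1 × A2)) (condKer2 n) (hφ2 n)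
  refine ⟨⟨ν1, hp1, hu1, hf1⟩, ⟨ν2, hp2, hu2, hf2⟩, fun x => ?_⟩
  obtain ⟨hstep, hadm1, hadm2⟩ := hmem x
  have hfx := hfix x
  generalize ξ x = p at *
  have hφ (n : ℕ) : ∀ᵐ h ∂(p : Measure (TrajM X A1 A2)).map (hProjM n),
      ξ (firstM (infoM h)) = p := by
    have hm : Measurable fun h : HistM X A1 A2 n => firstM (infoM h) :=
      measurable_firstM.comp measurable_infoM
    refine ae_of_ae_map (p := fun y => ξ y = p) hm.aemeasurable ?_
    rw [Measure.map_map hm (measurable_hProjM n)]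
    convert hfx using 2
    exact congrArg (Measure.map · _) (funext fun ω => firstM_iProjM n ω)
  have hν1 (n : ℕ) : ∀ᵐ h ∂(p : Measure (TrajM X A1 A2)).map (hProjM n),
      ν1 n (infoM h) = (condKer1 n).sectR p (infoM h) := by
    have h1 := (measure_adm_eq_one_iff hΓ1 continuous_snd (measurable_iProjM n)
      (by fun_prop) p).1 (hadm1 n)
    rw [← map_infoM_map_hProjM] at h1
    filter_upwards [hφ n, ae_of_ae_map measurable_infoM.aemeasurable h1] with h h2 h3
    rw [he1 n (infoM h) (by rw [h2]; exact h3), h2, Kernel.sectR_apply]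
  have hν2 (n : ℕ) : ∀ᵐ h ∂(p : Measure (TrajM X A1 A2)).map (hProjM n),
      ν2 n h = (condKer2 n).sectR p h := by
    have h1 := (measure_adm_eq_one_iff hΓ2 continuous_snd (measurable_hProjM n)
      (by fun_prop) p).1 (hadm2 n)
    filter_upwards [hφ n, h1] with h h2 h3
    rw [he2 n h (by rw [h2]; exact h3), h2, Kernel.sectR_apply]
  have hS (n : ℕ) : ∀ g, AEMeasurable g ((p : Measure (TrajM X A1 A2)).map (hProjM n)) →
      histIntM ((p : Measure (TrajM X A1 A2)).map fun ω => (ω 0).1) q ν1 ν2 n g =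
        ∫⁻ h, g h ∂(p : Measure (TrajM X A1 A2)).map (hProjM n) := by
    induction n with
    | zero => exact histIntM_zero_eq_lintegral (map_hProjM_zero p)
    | succ n ih => exact histIntM_succ_eq_lintegral ih (hν1 n) (hν2 n) (hstep n)
  intro n B hB
  rw [hS n _ (measurable_const.indicator hB).aemeasurable, lintegral_indicator_const hB, one_mul,
    Measure.map_apply (measurable_hProjM n) hB]
  rfl

lemma SM_eq {q : Kernel (X × A1 × A2) X} [IsMarkovKernel q]
    {Acts1 : X → Set A1} {Acts2 : X → Set A2}
    (hne1 : ∀ x, (Acts1 x).Nonempty) (hne2 : ∀ x, (Acts2 x).Nonempty)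
    (hΓ1 : AnalyticSet {xa : X × A1 | xa.2 ∈ Acts1 xa.1})
    (hΓ2 : AnalyticSet {xa : X × A2 | xa.2 ∈ Acts2 xa.1}) :
    SM q Acts1 Acts2 = stepSet q ∩ (admSet1 A2 Acts1 ∩ admSet2 A1 Acts2) := by
  refine Set.Subset.antisymm (fun p ⟨π1, π2, p0, h⟩ => mem_of_inducesM hΓ1 hΓ2 h) fun p hp => ?_
  obtain ⟨π1, π2, h⟩ := exists_policies_inducesM hne1 hne2 hΓ1 hΓ2 (ξ := fun _ => p)
    (@measurable_const _ _ _ (univSigma X) _) (fun _ => hp) fun _ =>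
      Eventually.of_forall fun _ => rfl
  have hx : Measurable fun ω : TrajM X A1 A2 => (ω 0).1 := by fun_prop
  obtain ⟨ω⟩ := nonempty_of_isProbabilityMeasure p
  exact ⟨π1, π2, p.map hx.aemeasurable, h (ω 0).1⟩

end Model

section Sections

lemma analyticSet_inter {Y : Type*} [TopologicalSpace Y] [T2Space Y] {s t : Set Y}
    (hs : AnalyticSet s) (ht : AnalyticSet t) : AnalyticSet (s ∩ t) := by
  rw [Set.inter_eq_iInter]
  exact AnalyticSet.iInter fun b => by cases b <;> assumption

lemma analyticSet_preimage_snd {X Y : Type*} [TopologicalSpace X] [PolishSpace X]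
    [TopologicalSpace Y] {s : Set Y} (hs : AnalyticSet s) :
    AnalyticSet (Prod.snd ⁻¹' s : Set (X × Y)) := by
  rw [AnalyticSet] at hs
  rcases hs with rfl | ⟨f, hf, rfl⟩
  · exact analyticSet_empty
  · have : (Prod.snd ⁻¹' Set.range f : Set (X × Y)) = Set.range (Prod.map id f) := by
      rw [Set.range_prodMap, Set.range_id, Set.univ_prod]
    rw [this]
    exact analyticSet_range_of_polishSpace (continuous_id.prodMap hf)

/-- The pairs of a point and a measure for which the given coordinate is almost surely equal to
the point form a Borel set. -/
lemma measurableSet_map_eq_dirac {X Ω : Type*} [TopologicalSpace X] [PolishSpace X]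
    [MeasurableSpace X] [BorelSpace X] [TopologicalSpace Ω] [PolishSpace Ω] [MeasurableSpace Ω]
    [BorelSpace Ω] {w : Ω → X} (hw : Measurable w) :
    MeasurableSet {xp : X × ProbabilityMeasure Ω |
      (xp.2 : Measure Ω).map w = Measure.dirac xp.1} := by
  let f : X × ProbabilityMeasure Ω → ProbabilityMeasure X := fun xp => xp.2.map hw.aemeasurable
  let g : X × ProbabilityMeasure Ω → ProbabilityMeasure X :=
    fun xp => ⟨Measure.dirac xp.1, inferInstance⟩
  have hf : Measurable f := measurable_of_measurable_toMeasure
    ((Measure.measurable_map w hw).comp (measurable_toMeasure.comp measurable_snd))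
  have hg : Measurable g :=
    measurable_of_measurable_toMeasure (Measure.measurable_dirac.comp measurable_fst)
  have key := measurableSet_eq_fun hf hg
  convert key using 3 with xp
  exact (Subtype.ext_iff (a1 := f xp) (a2 := g xp)).symm

end Sections

/-- Proposition `prp-minmax-strm1`: for the minimax control model,
(i) `S_M` and `tilde-S_M` are analytic, and Borel if `Γ₁`, `Γ₂` are Borel;
(ii) every universally measurable selection `ζ : 𝕏 → P(Ω)` of `tilde-S_M` is realized by
a pair of universally measurable policies. -/
theorem statement15
    {X A1 A2 : Type*}
    [TopologicalSpace X] [PolishSpace X] [MeasurableSpace X] [BorelSpace X]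
    [TopologicalSpace A1] [PolishSpace A1] [MeasurableSpace A1] [BorelSpace A1]
    [TopologicalSpace A2] [PolishSpace A2] [MeasurableSpace A2] [BorelSpace A2]
    (q : Kernel (X × A1 × A2) X) [IsMarkovKernel q]
    (Acts1 : X → Set A1) (Acts2 : X → Set A2)
    (hne1 : ∀ x, (Acts1 x).Nonempty) (hne2 : ∀ x, (Acts2 x).Nonempty)
    (hΓ1 : MeasureTheory.AnalyticSet {xa : X × A1 | xa.2 ∈ Acts1 xa.1})
    (hΓ2 : MeasureTheory.AnalyticSet {xa : X × A2 | xa.2 ∈ Acts2 xa.1}) :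
    -- (i)
    ((MeasureTheory.AnalyticSet (SM q Acts1 Acts2) ∧
      MeasureTheory.AnalyticSet (tsetM q Acts1 Acts2)) ∧
     (MeasurableSet {xa : X × A1 | xa.2 ∈ Acts1 xa.1} →
      MeasurableSet {xa : X × A2 | xa.2 ∈ Acts2 xa.1} →
      MeasurableSet (SM q Acts1 Acts2) ∧ MeasurableSet (tsetM q Acts1 Acts2))) ∧
    -- (ii)
    (∀ ζ : X → ProbabilityMeasure (TrajM X A1 A2), UniversallyMeasurable ζ →
      (∀ x, ζ x ∈ tsecM q Acts1 Acts2 x) →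
      ∃ (π1 : Policy1 Acts1) (π2 : Policy2 A1 Acts2),
        ∀ x, InducesM q π1 π2 (Measure.dirac x) (ζ x).toMeasure) := by
  rcases isEmpty_or_nonempty X with hX | ⟨⟨x₀⟩⟩
  · have : IsEmpty (ProbabilityMeasure (TrajM X A1 A2)) :=
      ⟨fun p => (nonempty_of_isProbabilityMeasure p).elim fun ω => isEmptyElim (ω 0).1⟩
    rw [Set.eq_empty_of_isEmpty (SM q Acts1 Acts2), Set.eq_empty_of_isEmpty (tsetM q Acts1 Acts2)]
    refine ⟨⟨⟨analyticSet_empty, analyticSet_empty⟩, fun _ _ => ⟨.empty, .empty⟩⟩, fun ζ _ _ => ?_⟩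
    refine ⟨⟨fun n i => isEmptyElim i.2, fun n i => isEmptyElim i.2, fun n B hB s hs μ hμ => ?_,
      fun n i => isEmptyElim i.2⟩, ⟨fun n i => isEmptyElim i.2, fun n i => isEmptyElim i.2,
      fun n B hB s hs μ hμ => ?_, fun n i => isEmptyElim i.2⟩, isEmptyElim⟩ <;>
    · rw [Set.eq_empty_of_isEmpty (_ ⁻¹' s)]
      exact MeasurableSet.empty.nullMeasurableSet
  have : Nonempty A1 := (hne1 x₀).to_subtype.map Subtype.val
  have : Nonempty A2 := (hne2 x₀).to_subtype.map Subtype.val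
  have hx : Measurable fun ω : TrajM X A1 A2 => (ω 0).1 := by fun_prop
  have hD := measurableSet_map_eq_dirac hx
  have htset : tsetM q Acts1 Acts2 = (Prod.snd ⁻¹' SM q Acts1 Acts2) ∩
      {xp | (xp.2 : Measure (TrajM X A1 A2)).map (fun ω => (ω 0).1) = Measure.dirac xp.1} := rfl
  have hSM := SM_eq (q := q) hne1 hne2 hΓ1 hΓ2
  have hs (n : ℕ) : Continuous fun ω : TrajM X A1 A2 => (ω n).1 := by fun_prop
  have ha1 (n : ℕ) : Continuous fun ω : TrajM X A1 A2 => (ω n).2.1 := by fun_prop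
  have ha2 (n : ℕ) : Continuous fun ω : TrajM X A1 A2 => (ω n).2.2 := by fun_prop
  refine ⟨⟨?_, fun hB1 hB2 => ?_⟩, fun ζ hζ hmem => ?_⟩
  · have : AnalyticSet (SM q Acts1 Acts2) := by
      rw [hSM]
      exact analyticSet_inter (analyticSet_of_measurableSet (measurableSet_stepSet q))
        (analyticSet_inter (analyticSet_prob_adm hΓ1 hs ha1) (analyticSet_prob_adm hΓ2 hs ha2))
    refine ⟨this, ?_⟩
    rw [htset]
    exact analyticSet_inter (analyticSet_preimage_snd this) (analyticSet_of_measurableSet_prod hD)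
  · have : MeasurableSet (SM q Acts1 Acts2) := by
      rw [hSM]
      exact (measurableSet_stepSet q).inter
        ((measurableSet_prob_adm hB1 hs ha1).inter (measurableSet_prob_adm hB2 hs ha2))
    refine ⟨this, ?_⟩
    rw [htset]
    exact (measurable_snd this).inter hD
  · obtain ⟨π1, π2, h⟩ := exists_policies_inducesM (q := q) hne1 hne2 hΓ1 hΓ2 (ξ := ζ)
      (fun s hs => hζ s hs) (fun x => hSM ▸ (hmem x).1) fun x => by
        rw [(hmem x).2, ae_dirac_eq]
        rfl
    exact ⟨π1, π2, fun x => (hmem x).2 ▸ h x⟩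

end PaperStmt
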